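/- arXiv:1808.09366 — 8 statements merged into one kernel-verified Lean document; each statement's English description precedes it below -/
import Mathlib

section
/- For every λ ∈ J*, one has H_{GλU} = H_{Gλ} and H_{UλU} = H_{Uλ}: an element r ∈ L satisfies Ad_r*μ = μ for every μ in the two-sided orbit GλU = {gλu : g ∈ G, u ∈ U} if and only if Ad_r*μ = μ for every μ ∈ Gλ = {gλ : g ∈ G}; likewise, r fixes every element of UλU under Ad* if and only if it fixes every element of Uλ. -/
open scoped Classical

/-- If a linear functional `f` and all its translates `x ↦ f (x + x * w)` are invariant under a
surjective multiplicative map `c`, then so are the two-sided translates of `f`. -/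
theorem twoSided_invariant_of_oneSided_invariant {F J : Type*} [Field F] [NonUnitalRing J]
    [Module F J] (f : Module.Dual F J) (c : J → J) (c_mul : ∀ x y, c (x * y) = c x * c y)
    (c_surj : Function.Surjective c)
    (hf : ∀ w x : J, f (c x + c x * w) = f (x + x * w)) (w z x : J) :
    f ((c x + z * c x) + (c x + z * c x) * w) = f ((x + z * x) + (x + z * x) * w) := by
  have f_c (x : J) : f (c x) = f x := by simpa using hf 0 x
  have f_c_mul (x w : J) : f (c x * w) = f (x * w) := by
    simpa [map_add, f_c] using hf w x
  obtain ⟨y, rfl⟩ := c_surj z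
  have left_mul : f (c y * c x) = f (c y * x) := by rw [← c_mul, f_c, f_c_mul]
  have both_mul : f (c y * c x * w) = f (c y * x * w) := by
    rw [← c_mul, f_c_mul, mul_assoc, mul_assoc, f_c_mul]
  simp only [map_add, add_mul, f_c, left_mul, both_mul, f_c_mul x]

theorem stmt_0
    (F : Type) [Field F] [Fintype F]
    (J : Type) [NonUnitalRing J] [Module F J]
    [SMulCommClass F J J] [IsScalarTower F J J] [Fintype J]
    (hnil : ∃ N : ℕ, ∀ x : ℕ → J,
      (List.range N).foldr (fun i acc => x i * acc) (x N) = 0)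
    (L : Type) [Group L] [Fintype L]
    (lact : L → J → J) (ract : J → L → J)
    (hlactlin : ∀ h : L, IsLinearMap F (lact h))
    (hractlin : ∀ h : L, IsLinearMap F (fun x => ract x h))
    (hlact_one : ∀ x : J, lact 1 x = x)
    (hlact_mul : ∀ h k : L, ∀ x : J, lact (h * k) x = lact h (lact k x))
    (hract_one : ∀ x : J, ract x 1 = x)
    (hract_mul : ∀ h k : L, ∀ x : J, ract x (h * k) = ract (ract x h) k)
    (hcomm : ∀ h k : L, ∀ x : J, ract (lact h x) k = lact h (ract x k))
    (hlmul : ∀ h : L, ∀ x y : J, lact h (x * y) = lact h x * y)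
    (hrmul : ∀ h : L, ∀ x y : J, ract (x * y) h = x * ract y h)
    (hmid : ∀ h : L, ∀ x y : J, x * lact h y = ract x h * y)
    (lam : Module.Dual F J) (r : L) :
    ((∀ μ : Module.Dual F J,
        (∃ (k : L) (w z : J), ∀ x : J,
          μ x = lam (ract (x + z * x) k + ract (x + z * x) k * w)) →
        ∀ x : J, μ (ract (lact r⁻¹ x) r) = μ x) ↔
      (∀ μ : Module.Dual F J,
        (∃ (k : L) (w : J), ∀ x : J, μ x = lam (ract x k + ract x k * w)) →
        ∀ x : J, μ (ract (lact r⁻¹ x) r) = μ x)) ∧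
    ((∀ μ : Module.Dual F J,
        (∃ (w z : J), ∀ x : J, μ x = lam ((x + z * x) + (x + z * x) * w)) →
        ∀ x : J, μ (ract (lact r⁻¹ x) r) = μ x) ↔
      (∀ μ : Module.Dual F J,
        (∃ w : J, ∀ x : J, μ x = lam (x + x * w)) →
        ∀ x : J, μ (ract (lact r⁻¹ x) r) = μ x)) := by
  have lact_inv (h : L) (x : J) : lact h (lact h⁻¹ x) = x := by
    rw [← hlact_mul, mul_inv_cancel, hlact_one]
  have ract_inv (h : L) (x : J) : ract (ract x h⁻¹) h = x := by
    rw [← hract_mul, inv_mul_cancel, hract_one]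
  have ract_add (h : L) (x y : J) : ract (x + y) h = ract x h + ract y h :=
    (hractlin h).map_add x y
  have conj_mul (x y : J) : ract (lact r⁻¹ (x * y)) r =
      ract (lact r⁻¹ x) r * ract (lact r⁻¹ y) r := by
    rw [← hmid, ← hcomm, lact_inv, hlmul, hrmul]
  have conj_surj : Function.Surjective fun x => ract (lact r⁻¹ x) r := fun x =>
    ⟨lact r (ract x r⁻¹), by
      simp only [← hlact_mul, inv_mul_cancel, hlact_one, ract_inv]⟩
  have ract_mul_translate (k : L) (w y : J) :
      ract (y + y * ract (lact k w) k⁻¹) k = ract y k + ract y k * w := by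
    rw [ract_add, hrmul, ract_inv, hmid]
  refine ⟨⟨fun H μ ⟨k, w, hμ⟩ => H μ ⟨k, w, 0, by simpa using hμ⟩, ?_⟩,
    ⟨fun H μ ⟨w, hμ⟩ => H μ ⟨w, 0, by simpa using hμ⟩, ?_⟩⟩
  · rintro H μ ⟨k, w, z, hμ⟩ x
    let lamk : Module.Dual F J := lam ∘ₗ (hractlin k).mk'
    have hlamk (w x : J) : lamk (ract (lact r⁻¹ x) r + ract (lact r⁻¹ x) r * w) =
        lamk (x + x * w) := by
      refine H (lamk ∘ₗ (LinearMap.id + LinearMap.mulRight F w))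
        ⟨k, lact k⁻¹ (ract w k), fun y => ?_⟩ x
      change lam (ract (y + y * w) k) = _
      rw [ract_add, hrmul, hmid, ← hract_mul, mul_inv_cancel, hract_one]
    rw [hμ, hμ, ← ract_mul_translate, ← ract_mul_translate]
    exact twoSided_invariant_of_oneSided_invariant lamk _ conj_mul conj_surj hlamk _ z x
  · rintro H μ ⟨w, z, hμ⟩ x
    rw [hμ, hμ]
    exact twoSided_invariant_of_oneSided_invariant lam _ conj_mul conj_surj
      (fun w => H (lam ∘ₗ (LinearMap.id + LinearMap.mulRight F w)) ⟨w, fun _ => rfl⟩) w z x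
end

section
/- Let λ ∈ J*, let H₀ be a subgroup of H_λ, and let θ : H₀ → ℂ^× be a group homomorphism. Then the map ξ_{θ,λ} defined on the subgroup G_{0,λ} = H₀ ⋉ U_{λ,rt} of G by ξ_{θ,λ}(h(1+x)) = θ(h)·ε^{λ(x)} for h ∈ H₀ and x ∈ J_{λ,rt} is a group homomorphism G_{0,λ} → ℂ^×. -/
open scoped Classical

theorem stmt_1
    (F : Type) [Field F] [Fintype F]
    (J : Type) [NonUnitalRing J] [Module F J]
    [SMulCommClass F J J] [IsScalarTower F J J] [Fintype J]
    (hnil : ∃ N : ℕ, ∀ x : ℕ → J,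
      (List.range N).foldr (fun i acc => x i * acc) (x N) = 0)
    (L : Type) [Group L] [Fintype L]
    (lact : L → J → J) (ract : J → L → J)
    (hlactlin : ∀ h : L, IsLinearMap F (lact h))
    (hractlin : ∀ h : L, IsLinearMap F (fun x => ract x h))
    (hlact_one : ∀ x : J, lact 1 x = x)
    (hlact_mul : ∀ h k : L, ∀ x : J, lact (h * k) x = lact h (lact k x))
    (hract_one : ∀ x : J, ract x 1 = x)
    (hract_mul : ∀ h k : L, ∀ x : J, ract x (h * k) = ract (ract x h) k)
    (hcomm : ∀ h k : L, ∀ x : J, ract (lact h x) k = lact h (ract x k))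
    (hlmul : ∀ h : L, ∀ x y : J, lact h (x * y) = lact h x * y)
    (hrmul : ∀ h : L, ∀ x y : J, ract (x * y) h = x * ract y h)
    (hmid : ∀ h : L, ∀ x y : J, x * lact h y = ract x h * y)
    (G : Type) [Group G] [Fintype G]
    (ρ : L →* G) (em : J → G)
    (hem : ∀ x y : J, em x * em y = em (x + y + x * y))
    (hsplit : Function.Bijective (fun p : L × J => ρ p.1 * em p.2))
    (hconj : ∀ (h : L) (x : J), ρ h * em x * (ρ h)⁻¹ = em (lact h (ract x h⁻¹)))
    (ε : AddChar F ℂ) (hε : ε ≠ 1)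
    (lam : Module.Dual F J)
    (H₀ : Subgroup L)
    (hH₀ : ∀ h ∈ H₀, ∀ x : J, lam (ract (lact h⁻¹ x) h) = lam x)
    (θ : ↥H₀ →* ℂˣ) :
    ∀ (h₁ h₂ : ↥H₀) (x₁ x₂ : J),
      (∀ z : J, lam (x₁ * z) = 0) → (∀ z : J, lam (x₂ * z) = 0) →
      ∃ (h₃ : ↥H₀) (x₃ : J), (∀ z : J, lam (x₃ * z) = 0) ∧
        (ρ ↑h₁ * em x₁) * (ρ ↑h₂ * em x₂) = ρ ↑h₃ * em x₃ ∧
        ((θ h₃ : ℂˣ) : ℂ) * ε (lam x₃) =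
          (((θ h₁ : ℂˣ) : ℂ) * ε (lam x₁)) * (((θ h₂ : ℂˣ) : ℂ) * ε (lam x₂)) := by
  intro h₁ h₂ x₁ x₂ hx₁ hx₂
  obtain ⟨h₂, hh₂⟩ := h₂
  set y : J := lact h₂⁻¹ (ract x₁ h₂) with hy
  have lam_conj : ∀ w : J, lam (lact h₂⁻¹ (ract w h₂)) = lam w := fun w => by
    rw [← hcomm, hH₀ h₂ hh₂]
  have lam_y_mul : ∀ z : J, lam (y * z) = 0 := fun z => by
    have hyz : y * z = lact h₂⁻¹ (ract (x₁ * lact h₂ (ract z h₂⁻¹)) h₂) := by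
      rw [hrmul, hcomm, ← hract_mul, inv_mul_cancel, hract_one, hmid, hlmul]
    rw [hyz, lam_conj, hx₁]
  have em_mul_ρ : em x₁ * ρ h₂ = ρ h₂ * em y := by
    have hc := hconj h₂⁻¹ x₁
    rw [inv_inv, map_inv, inv_inv, ← hy] at hc
    rw [← hc]
    group
  refine ⟨h₁ * ⟨h₂, hh₂⟩, y + x₂ + y * x₂, fun z => ?_, ?_, ?_⟩
  · rw [add_mul, add_mul, mul_assoc, map_add, map_add, lam_y_mul, lam_y_mul, hx₂]
    simp
  · rw [← hem, Subgroup.coe_mul, map_mul]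
    calc ρ h₁ * em x₁ * (ρ h₂ * em x₂) = ρ h₁ * (em x₁ * ρ h₂) * em x₂ := by group
      _ = ρ h₁ * ρ h₂ * (em y * em x₂) := by rw [em_mul_ρ]; group
  · rw [map_add lam, map_add lam, lam_y_mul, add_zero, hy, lam_conj, AddChar.map_add_eq_mul,
      map_mul, Units.val_mul]
    ring
end

section
/- For every λ ∈ J* and every x ∈ J, the sum Σ_{u∈U} ε^{λ(xu)} equals |U|·ε^{λ(x)} if x ∈ J_{λ,rt}, and equals 0 if x ∉ J_{λ,rt}. -/
open scoped Classical

theorem stmt_3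
    (F : Type) [Field F] [Fintype F]
    (J : Type) [NonUnitalRing J] [Module F J]
    [SMulCommClass F J J] [IsScalarTower F J J] [Fintype J]
    (hnil : ∃ N : ℕ, ∀ x : ℕ → J,
      (List.range N).foldr (fun i acc => x i * acc) (x N) = 0)
    (ε : AddChar F ℂ) (hε : ε ≠ 1)
    (lam : Module.Dual F J) (x : J) :
    (∑ y : J, ε (lam (x + x * y))) =
      if (∀ z : J, lam (x * z) = 0) then (Fintype.card J : ℂ) * ε (lam x) else 0 := by
  let ψ : AddChar J ℂ :=
    ε.compAddMonoidHom (lam.toAddMonoidHom.comp (AddMonoidHom.mulLeft x))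
  have hψ (y : J) : ψ y = ε (lam (x * y)) := rfl
  have hsum : ∑ y : J, ε (lam (x + x * y)) = ε (lam x) * ∑ y : J, ψ y := by
    simp only [map_add, AddChar.map_add_eq_mul, Finset.mul_sum, hψ]
  rw [hsum]
  split_ifs with h
  · simp [hψ, h, mul_comm]
  · push Not at h
    obtain ⟨z, hz⟩ := h
    obtain ⟨a, ha⟩ := AddChar.ne_one_iff.1 hε
    have hne : ψ ≠ 1 := by
      refine AddChar.ne_one_iff.2 ⟨(a / lam (x * z)) • z, ?_⟩
      rwa [hψ, mul_smul_comm, map_smul, smul_eq_mul, div_mul_cancel₀ a hz]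
    rw [AddChar.sum_eq_zero_of_ne_one hne, mul_zero]
end

section
/- Let λ ∈ J*, let H₀ be a subgroup of H_{Gλ}, and let θ be the character of a complex representation of H₀. For p ∈ L define ξ_{θ,pλ} on G_{0,λ} = H₀ ⋉ U_{λ,rt} by ξ_{θ,pλ}(h(1+x)) = θ(h)·ε^{(pλ)(x)}, and let χ_{θ,λ} = Ind_{G_{0,λ}}^G (Σ_{p∈L} ξ_{θ,pλ}). Then for every g = h(1+x) ∈ G with h ∈ L and x ∈ J: χ_{θ,λ}(g) = (|L|·|λU|)/(|H₀|·|GλU|) · Σ_{r∈L} θ̇(rhr^{-1}) · (Σ_{μ∈GλU} ε^{μ(rxr^{-1})}), where θ̇ equals θ on H₀ and 0 on L∖H₀, λU = {λu : u ∈ U}, GλU = {gλu : g ∈ G, u ∈ U}, and rxr^{-1} denotes the left action of r and the right action of r^{-1} applied to x. -/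
open scoped Classical

/-- If a finite set `T` of injective self-maps of `X` is closed under composition through a
right-cancellative operation, averaging over `T` agrees with averaging over an orbit. -/
theorem card_mul_finsum_mem_range {T X : Type*} [Fintype T] (a : T → X → X) (m : T → T → T)
    (hm : ∀ t₀, Function.Injective fun t => m t t₀) (ha : ∀ t, Function.Injective (a t))
    (hcomp : ∀ t t₀ x, a t (a t₀ x) = a (m t t₀) x) (f : X → ℂ) (x₀ : X) :
    (Fintype.card T : ℂ) * ∑ᶠ μ ∈ Set.range (fun t => a t x₀), f μ =
      (Nat.card (Set.range fun t => a t x₀) : ℂ) * ∑ t, f (a t x₀) := by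
  set O : Finset X := Finset.univ.image fun t => a t x₀ with hO
  have hrange : Set.range (fun t => a t x₀) = (O : Set X) := by simp [hO]
  rw [hrange, finsum_mem_coe_finset, Nat.card_eq_card_toFinset, Finset.toFinset_coe]
  have hstable : ∀ t, O.image (a t) = O := fun t => by
    apply Finset.eq_of_subset_of_card_le
    · intro μ hμ
      simp only [hO, Finset.mem_image, Finset.mem_univ, true_and] at hμ ⊢
      obtain ⟨_, ⟨t₀, rfl⟩, rfl⟩ := hμ
      exact ⟨m t t₀, (hcomp t t₀ x₀).symm⟩
    · rw [Finset.card_image_of_injective _ (ha t)]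
  have hleft : ∀ t, ∑ μ ∈ O, f (a t μ) = ∑ μ ∈ O, f μ := fun t => by
    conv_rhs => rw [← hstable t]
    rw [Finset.sum_image fun _ _ _ _ e => ha t e]
  have hright : ∀ μ ∈ O, ∑ t, f (a t μ) = ∑ t, f (a t x₀) := fun μ hμ => by
    simp only [hO, Finset.mem_image, Finset.mem_univ, true_and] at hμ
    obtain ⟨t₀, rfl⟩ := hμ
    simp only [hcomp]
    exact (Finite.injective_iff_bijective.mp (hm t₀)).sum_comp fun t => f (a t x₀)
  calc (Fintype.card T : ℂ) * ∑ μ ∈ O, f μ = ∑ t, ∑ μ ∈ O, f (a t μ) := by simp [hleft]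
    _ = ∑ μ ∈ O, ∑ t, f (a t μ) := Finset.sum_comm
    _ = (O.card : ℂ) * ∑ t, f (a t x₀) := by simp [Finset.sum_congr rfl hright]

/-- Commuting linear left and right actions of `L` on `J`, compatible with its product. -/
structure IsBiaction (F : Type*) {J L : Type*} [Field F] [NonUnitalRing J] [Module F J] [Group L]
    (lact : L → J → J) (ract : J → L → J) : Prop where
  lin_left : ∀ h, IsLinearMap F (lact h)
  lin_right : ∀ h, IsLinearMap F (fun x => ract x h)
  one_left : ∀ x, lact 1 x = x
  mul_left : ∀ h k x, lact (h * k) x = lact h (lact k x)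
  one_right : ∀ x, ract x 1 = x
  mul_right : ∀ h k x, ract x (h * k) = ract (ract x h) k
  comm : ∀ h k x, ract (lact h x) k = lact h (ract x k)
  left_mul : ∀ h x y, lact h (x * y) = lact h x * y
  right_mul : ∀ h x y, ract (x * y) h = x * ract y h
  mid : ∀ h x y, x * lact h y = ract x h * y

namespace IsBiaction

variable {F J L : Type*} [Field F] [NonUnitalRing J] [Module F J] [Group L]
  {lact : L → J → J} {ract : J → L → J}

theorem ract_add (B : IsBiaction F lact ract) (x y : J) (k : L) :
    ract (x + y) k = ract x k + ract y k := (B.lin_right k).map_add x y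

theorem ract_sub (B : IsBiaction F lact ract) (x y : J) (k : L) :
    ract (x - y) k = ract x k - ract y k := (B.lin_right k).map_sub x y

theorem ract_inv_ract (B : IsBiaction F lact ract) (x : J) (k : L) :
    ract (ract x k) k⁻¹ = x := by rw [← B.mul_right, mul_inv_cancel, B.one_right]

theorem lact_lact_inv (B : IsBiaction F lact ract) (k : L) (x : J) :
    lact k (lact k⁻¹ x) = x := by rw [← B.mul_left, mul_inv_cancel, B.one_left]

theorem conj_injective (B : IsBiaction F lact ract) (k : L) :
    Function.Injective fun x => lact k⁻¹ (ract x k) := fun x y e => by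
  have h := congrArg (fun z => ract (lact k z) k⁻¹) e
  simpa only [B.lact_lact_inv, B.ract_inv_ract] using h

/-- Moving `1 + y` across the right action of `k`. -/
theorem ract_mul_conj (B : IsBiaction F lact ract) (x y : J) (k : L) :
    ract x k * lact k⁻¹ (ract y k) = ract (x * y) k := by
  rw [B.mid, B.ract_inv_ract, B.right_mul]

/-- Orthogonality: summing over the right translates of `λ` detects the right annihilator. -/
theorem sum_translate_eq_ite [SMulCommClass F J J] [Fintype J] [Fintype L] (B : IsBiaction F lact ract)
    (ε : AddChar F ℂ) (hε : ε ≠ 1) (lam : Module.Dual F J) (v : J) :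
    ∑ k : L, ∑ w : J, ε (lam (ract v k + ract v k * w)) =
      (Fintype.card J : ℂ) *
        if v ∈ {z : J | ∀ w : J, lam (z * w) = 0} then ∑ k : L, ε (lam (ract v k)) else 0 := by
  have hsum : ∀ k : L, ∑ w : J, ε (lam (ract v k * w)) =
      if v ∈ {z : J | ∀ w : J, lam (z * w) = 0} then (Fintype.card J : ℂ) else 0 := fun k => by
    split_ifs with hv
    · simp [← B.mid, hv _]
    · simp only [Set.mem_ofPred_eq, not_forall] at hv
      obtain ⟨w₀, hw₀⟩ := hv
      obtain ⟨c, hc⟩ := AddChar.ne_one_iff.mp hε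
      let ψ : AddChar J ℂ :=
        ε.compAddMonoidHom (lam ∘ₗ LinearMap.mulLeft F (ract v k)).toAddMonoidHom
      refine AddChar.sum_eq_zero_of_ne_one (ψ := ψ) (AddChar.ne_one_iff.mpr
        ⟨lact k⁻¹ ((c / lam (v * w₀)) • w₀), ?_⟩)
      change ε (lam (ract v k * lact k⁻¹ ((c / lam (v * w₀)) • w₀))) ≠ 1
      rwa [B.mid, B.ract_inv_ract, mul_smul_comm, map_smul, smul_eq_mul, div_mul_cancel₀ _ hw₀]
  simp only [map_add, AddChar.map_add_eq_mul, ← Finset.mul_sum, hsum]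
  split_ifs
  · rw [← Finset.sum_mul, mul_comm]
  · simp

/-- Summing over the right translates of `λ` is invariant under right multiplication by `1 + y`. -/
theorem sum_translate_add_mul [Fintype J] [Fintype L] (B : IsBiaction F lact ract)
    (hl : ∀ y : J, Function.Injective fun z => y + z + y * z) (f : J → ℂ) (v y : J) :
    ∑ k : L, ∑ w : J, f (ract (v + v * y) k + ract (v + v * y) k * w) =
      ∑ k : L, ∑ w : J, f (ract v k + ract v k * w) := by
  refine Finset.sum_congr rfl fun k _ => ?_
  refine Eq.trans ?_ ((Finite.injective_iff_bijective.mp (hl (lact k⁻¹ (ract y k)))).sum_comp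
    fun w => f (ract v k + ract v k * w))
  refine Finset.sum_congr rfl fun w _ => congrArg f ?_
  simp only [mul_add, ← mul_assoc, B.ract_mul_conj, B.ract_add, add_mul]
  abel

variable [SMulCommClass F J J] [IsScalarTower F J J]

/-- The linear map `x ↦ (1 + z) x k (1 + w)`, indexed by `(k, w, z)`. -/
noncomputable def translate (B : IsBiaction F lact ract) (t : L × J × J) : J →ₗ[F] J :=
  (LinearMap.id + LinearMap.mulRight F t.2.1) ∘ₗ (B.lin_right t.1).mk' _ ∘ₗ
    (LinearMap.id + LinearMap.mulLeft F t.2.2)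

theorem translate_apply (B : IsBiaction F lact ract) (k : L) (w z x : J) :
    B.translate (k, w, z) x = ract (x + z * x) k + ract (x + z * x) k * w := rfl

theorem translate_translate (B : IsBiaction F lact ract) (k k₀ : L) (w w₀ z z₀ x : J) :
    B.translate (k₀, w₀, z₀) (B.translate (k, w, z) x) =
      B.translate (k * k₀, lact k₀⁻¹ (ract w k₀) + w₀ + lact k₀⁻¹ (ract w k₀) * w₀,
        z₀ + z + z₀ * z) x := by
  simp only [translate_apply, B.mul_right, B.ract_add, mul_add, add_mul, B.right_mul,
    ← mul_assoc, B.mid, B.ract_inv_ract]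
  abel

theorem translate_injective (B : IsBiaction F lact ract)
    (hl : ∀ y : J, Function.Injective fun z => y + z + y * z)
    (hr : ∀ y : J, Function.Injective fun z => z + y + z * y) (t : L × J × J) :
    Function.Injective (B.translate t) := by
  obtain ⟨k, w, z⟩ := t
  intro x x' e
  simp only [translate_apply] at e
  have e₁ : ract (x + z * x) k = ract (x' + z * x') k := hr w <| by
    simp only [add_right_comm _ w, e]
  have e₂ : x + z * x = x' + z * x' := by
    simpa only [B.ract_inv_ract] using congrArg (fun v => ract v k⁻¹) e₁
  exact hl z <| by simp only [add_assoc, e₂]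

/-- The average over all `gλu` is the average over the set `GλU`. -/
theorem card_mul_finsum_translate [Fintype J] [Fintype L] (B : IsBiaction F lact ract)
    (hl : ∀ y : J, Function.Injective fun z => y + z + y * z)
    (hr : ∀ y : J, Function.Injective fun z => z + y + z * y)
    (lam : Module.Dual F J) (f : Module.Dual F J → ℂ) :
    (Fintype.card (L × J × J) : ℂ) *
        ∑ᶠ μ ∈ Set.range (fun t => lam ∘ₗ B.translate t), f μ =
      (Nat.card (Set.range fun t => lam ∘ₗ B.translate t) : ℂ) *
        ∑ t, f (lam ∘ₗ B.translate t) := by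
  refine card_mul_finsum_mem_range (fun t (μ : Module.Dual F J) => μ ∘ₗ B.translate t)
    (fun t t₀ => (t.1 * t₀.1, lact t₀.1⁻¹ (ract t.2.1 t₀.1) + t₀.2.1 +
      lact t₀.1⁻¹ (ract t.2.1 t₀.1) * t₀.2.1, t₀.2.2 + t.2.2 + t₀.2.2 * t.2.2))
    ?_ ?_ ?_ f lam
  · rintro ⟨k₀, w₀, z₀⟩ ⟨k, w, z⟩ ⟨k', w', z'⟩ e
    simp only [Prod.mk.injEq, mul_left_inj] at e
    obtain ⟨rfl, ew, ez⟩ := e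
    rw [B.conj_injective k₀ (hr w₀ ew), hl z₀ ez]
  · intro t μ μ' e
    ext x
    obtain ⟨y, rfl⟩ :=
      (Finite.injective_iff_surjective.mp (B.translate_injective hl hr t)) x
    exact LinearMap.congr_fun e y
  · rintro ⟨k, w, z⟩ ⟨k₀, w₀, z₀⟩ μ
    ext x
    exact congrArg μ (B.translate_translate k k₀ w w₀ z z₀ x)

/-- Summing over all conjugates `1 + v y = (1 + h⁻¹yh)(1 + x)(1 + y)⁻¹`, when `h` fixes `Gλ`. -/
theorem sum_conj_translate [Fintype J] [Fintype L] (B : IsBiaction F lact ract)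
    (hl : ∀ y : J, Function.Injective fun z => y + z + y * z)
    (ε : AddChar F ℂ) (lam : Module.Dual F J) (h : L)
    (hfix : ∀ k w x, lam (ract (ract (lact h⁻¹ x) h) k + ract (ract (lact h⁻¹ x) h) k * w) =
      lam (ract x k + ract x k * w))
    (x : J) (v : J → J)
    (hv : ∀ y, v y + y + v y * y =
      lact h⁻¹ (ract y h) + x + lact h⁻¹ (ract y h) * x) :
    ∑ y : J, ∑ k : L, ∑ w : J, ε (lam (ract (v y) k + ract (v y) k * w)) =
      ∑ t : L × J × J, ε (lam (B.translate t x)) := by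
  have hterm : ∀ y, ∑ k : L, ∑ w : J, ε (lam (ract (v y) k + ract (v y) k * w)) =
      ∑ k : L, ∑ w : J, ε (lam (B.translate (k, w, lact h⁻¹ (ract y h)) x)) := fun y => by
    rw [← B.sum_translate_add_mul hl (fun v => ε (lam v)) (v y) y]
    refine Finset.sum_congr rfl fun k _ => Finset.sum_congr rfl fun w _ => congrArg ε ?_
    have hvy : v y + v y * y = lact h⁻¹ (ract y h) - y + (x + lact h⁻¹ (ract y h) * x) := by
      rw [eq_sub_of_add_eq ((add_right_comm _ _ _).trans (hv y))]
      abel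
    have hdiff := hfix k w y
    rw [B.comm] at hdiff
    rw [hvy, translate_apply, B.ract_add (_ - _), B.ract_sub, add_mul, sub_mul]
    simp only [map_add, map_sub] at hdiff ⊢
    linear_combination hdiff
  simp only [hterm]
  rw [(Finite.injective_iff_bijective.mp (B.conj_injective h)).sum_comp fun z =>
    ∑ k : L, ∑ w : J, ε (lam (B.translate (k, w, z) x))]
  simp only [Fintype.sum_prod_type]
  rw [Finset.sum_comm]
  exact Finset.sum_congr rfl fun k _ => Finset.sum_comm

end IsBiaction

/-- `|λU| · |J_{λ,rt}| = |J|`. -/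
theorem card_range_dual_mul_card_annihilator {F J : Type*} [Field F] [NonUnitalRing J] [Module F J]
    [SMulCommClass F J J] [IsScalarTower F J J] (lam : Module.Dual F J) :
    Nat.card {μ : Module.Dual F J | ∃ z : J, ∀ x : J, μ x = lam (x + z * x)} *
      Nat.card {z : J | ∀ w : J, lam (z * w) = 0} = Nat.card J := by
  let φ : J →+ Module.Dual F J :=
    { toFun := fun z => lam ∘ₗ LinearMap.mulLeft F z
      map_zero' := by ext; simp
      map_add' := fun z z' => by ext; simp [add_mul] }
  have hker : {z : J | ∀ w : J, lam (z * w) = 0} = (φ.ker : Set J) := by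
    ext z
    exact ⟨fun h => LinearMap.ext h, fun h w => LinearMap.congr_fun h w⟩
  have hrange : {μ : Module.Dual F J | ∃ z : J, ∀ x : J, μ x = lam (x + z * x)} =
      (lam + ·) '' (φ.range : Set (Module.Dual F J)) := by
    ext μ
    constructor
    · rintro ⟨z, hz⟩
      exact ⟨φ z, ⟨z, rfl⟩, LinearMap.ext fun x => by simp [hz, φ]⟩
    · rintro ⟨_, ⟨z, rfl⟩, rfl⟩
      exact ⟨z, fun x => by simp [φ]⟩
  rw [hker, hrange, Nat.card_image_of_injective (add_right_injective lam),
    AddSubgroup.card_eq_card_quotient_mul_card_addSubgroup φ.ker,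
    Nat.card_congr (QuotientAddGroup.quotientKerEquivRange φ).toEquiv]
  rfl

theorem stmt_5
    (F : Type) [Field F] [Fintype F]
    (J : Type) [NonUnitalRing J] [Module F J]
    [SMulCommClass F J J] [IsScalarTower F J J] [Fintype J]
    (hnil : ∃ N : ℕ, ∀ x : ℕ → J,
      (List.range N).foldr (fun i acc => x i * acc) (x N) = 0)
    (L : Type) [Group L] [Fintype L]
    (lact : L → J → J) (ract : J → L → J)
    (hlactlin : ∀ h : L, IsLinearMap F (lact h))
    (hractlin : ∀ h : L, IsLinearMap F (fun x => ract x h))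
    (hlact_one : ∀ x : J, lact 1 x = x)
    (hlact_mul : ∀ h k : L, ∀ x : J, lact (h * k) x = lact h (lact k x))
    (hract_one : ∀ x : J, ract x 1 = x)
    (hract_mul : ∀ h k : L, ∀ x : J, ract x (h * k) = ract (ract x h) k)
    (hcomm : ∀ h k : L, ∀ x : J, ract (lact h x) k = lact h (ract x k))
    (hlmul : ∀ h : L, ∀ x y : J, lact h (x * y) = lact h x * y)
    (hrmul : ∀ h : L, ∀ x y : J, ract (x * y) h = x * ract y h)
    (hmid : ∀ h : L, ∀ x y : J, x * lact h y = ract x h * y)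
    (G : Type) [Group G] [Fintype G]
    (ρ : L →* G) (em : J → G)
    (hem : ∀ x y : J, em x * em y = em (x + y + x * y))
    (hsplit : Function.Bijective (fun p : L × J => ρ p.1 * em p.2))
    (hconj : ∀ (h : L) (x : J), ρ h * em x * (ρ h)⁻¹ = em (lact h (ract x h⁻¹)))
    (ε : AddChar F ℂ) (hε : ε ≠ 1)
    (lam : Module.Dual F J)
    (H₀ : Subgroup L)
    (hH₀ : ∀ h ∈ H₀, ∀ μ : Module.Dual F J,
      (∃ (k : L) (w : J), ∀ x : J, μ x = lam (ract x k + ract x k * w)) →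
      ∀ x : J, μ (ract (lact h⁻¹ x) h) = μ x)
    (θ : L → ℂ)
    (hθ : ∃ W : FDRep ℂ ↥H₀, ∀ h : ↥H₀, θ ↑h = W.character h)
    (hθ0 : ∀ h : L, h ∉ H₀ → θ h = 0) :
    let dec : G → L × J :=
      @Function.invFun (L × J) G ⟨(1, 0)⟩ fun p : L × J => ρ p.1 * em p.2
    let Jrt : Set J := {z : J | ∀ w : J, lam (z * w) = 0}
    let GlaU : Set (Module.Dual F J) :=
      {μ | ∃ (k : L) (w z : J), ∀ x : J,
        μ x = lam (ract (x + z * x) k + ract (x + z * x) k * w)}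
    let laU : Set (Module.Dual F J) :=
      {μ | ∃ z : J, ∀ x : J, μ x = lam (x + z * x)}
    let ξdot : G → ℂ := fun s =>
      if (dec s).1 ∈ H₀ ∧ (dec s).2 ∈ Jrt then
        ∑ p : L, θ (dec s).1 * ε (lam (ract (dec s).2 p))
      else 0
    let χ : G → ℂ := fun g =>
      ((Nat.card ↥H₀ * Nat.card ↥Jrt : ℕ) : ℂ)⁻¹ * ∑ s : G, ξdot (s * g * s⁻¹)
    ∀ (h : L) (x : J),
      χ (ρ h * em x) =
        ((Fintype.card L : ℂ) * (Nat.card ↥laU : ℂ)) /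
            ((Nat.card ↥H₀ : ℂ) * (Nat.card ↥GlaU : ℂ)) *
          ∑ r : L, θ (r * h * r⁻¹) *
            ∑ᶠ μ ∈ GlaU, ε (μ (lact r (ract x r⁻¹))) := by
  intro dec Jrt GlaU laU ξdot χ h x
  have B : IsBiaction F lact ract :=
    ⟨hlactlin, hractlin, hlact_one, hlact_mul, hract_one, hract_mul, hcomm, hlmul, hrmul, hmid⟩
  have hem_inj : Function.Injective em := fun a b e => by
    have := @hsplit.1 (1, a) (1, b) (by simp [e])
    simpa using this
  have hl : ∀ y : J, Function.Injective fun z => y + z + y * z := fun y a b e => by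
    apply hem_inj
    simpa only [← hem, mul_right_inj] using congrArg em e
  have hr : ∀ y : J, Function.Injective fun z => z + y + z * y := fun y a b e => by
    apply hem_inj
    simpa only [← hem, mul_left_inj] using congrArg em e
  have hdec : ∀ a b, dec (ρ a * em b) = (a, b) := fun a b =>
    @Function.leftInverse_invFun _ _ ⟨(1, 0)⟩ _ hsplit.1 (a, b)
  have hcross : ∀ k y, em y * ρ k = ρ k * em (lact k⁻¹ (ract y k)) := fun k y => by
    have := hconj k⁻¹ y
    rw [inv_inv, map_inv, inv_inv] at this
    rw [← this]
    group
  have hbij : Function.Bijective fun p : L × J => em p.2 * ρ p.1 := by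
    have hshear : Function.Bijective fun p : L × J => (p.1, lact p.1⁻¹ (ract p.2 p.1)) := by
      refine Finite.injective_iff_bijective.mp ?_
      rintro ⟨a, b⟩ ⟨a', b'⟩ e
      simp only [Prod.mk.injEq] at e
      obtain ⟨rfl, e⟩ := e
      rw [B.conj_injective a e]
    convert hsplit.comp hshear using 1
    exact funext fun p => hcross p.1 p.2
  have hGlaU : GlaU = Set.range fun t => lam ∘ₗ B.translate t := by
    ext μ
    constructor
    · rintro ⟨k, w, z, e⟩
      exact ⟨(k, w, z), LinearMap.ext fun x => (e x).symm⟩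
    · rintro ⟨⟨k, w, z⟩, rfl⟩
      exact ⟨k, w, z, fun _ => rfl⟩
  have hJ : (Fintype.card J : ℂ) ≠ 0 := Nat.cast_ne_zero.mpr Fintype.card_ne_zero
  have hconjsum : ∀ r : L, (Fintype.card J : ℂ) *
      ∑ y : J, ξdot (em y * ρ r * (ρ h * em x) * (em y * ρ r)⁻¹) =
        θ (r * h * r⁻¹) * ∑ t, ε (lam (B.translate t (lact r (ract x r⁻¹)))) := fun r => by
    set h' := r * h * r⁻¹ with hh'
    set x' := lact r (ract x r⁻¹) with hx'
    choose v hv using fun y => Finite.injective_iff_surjective.mp (hr y)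
      (lact h'⁻¹ (ract y h') + x' + lact h'⁻¹ (ract y h') * x')
    have hs : ∀ y, em y * ρ r * (ρ h * em x) * (em y * ρ r)⁻¹ = ρ h' * em (v y) := fun y => by
      have hrg : ρ r * (ρ h * em x) * (ρ r)⁻¹ = ρ h' * em x' := by
        rw [hx', ← hconj, hh']
        simp only [map_mul, map_inv]
        group
      have hvy : em (v y) * em y = em (lact h'⁻¹ (ract y h')) * em x' := by
        rw [hem, hem]
        exact congrArg em (hv y)
      calc _ = em y * (ρ r * (ρ h * em x) * (ρ r)⁻¹) * (em y)⁻¹ := by group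
        _ = ρ h' * (em (lact h'⁻¹ (ract y h')) * em x') * (em y)⁻¹ := by
          rw [hrg, ← mul_assoc, hcross, mul_assoc (ρ h')]
        _ = _ := by rw [← hvy]; group
    simp only [hs, ξdot, hdec]
    by_cases hH : h' ∈ H₀
    · simp only [hH, true_and, ← Finset.mul_sum]
      rw [← B.sum_conj_translate hl ε lam h' (fun k w z => ?_) x' v hv]
      · simp only [B.sum_translate_eq_ite ε hε, Finset.mul_sum]
        refine Finset.sum_congr rfl fun y _ => ?_
        change _ * (if v y ∈ Jrt then _ else _) = _ * (_ * if v y ∈ Jrt then _ else _)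
        split_ifs
        · simp only [Finset.mul_sum]
          exact Finset.sum_congr rfl fun _ _ => by ring
        · simp
      · have := hH₀ h' hH (lam ∘ₗ B.translate (k, w, 0))
          ⟨k, w, fun z => by simp [B.translate_apply]⟩ z
        simpa [B.translate_apply] using this
    · simp [hH, hθ0 h' hH]
  have hsum : (Fintype.card J : ℂ) * ∑ s : G, ξdot (s * (ρ h * em x) * s⁻¹) =
      ∑ r : L, θ (r * h * r⁻¹) * ∑ t, ε (lam (B.translate t (lact r (ract x r⁻¹)))) := by
    rw [← hbij.sum_comp, Fintype.sum_prod_type, Finset.mul_sum]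
    exact Finset.sum_congr rfl fun r _ => hconjsum r
  have horbit : ∀ r : L,
      (Fintype.card L : ℂ) * (Fintype.card J * Fintype.card J) *
          ∑ᶠ μ ∈ GlaU, ε (μ (lact r (ract x r⁻¹))) =
        (Nat.card GlaU : ℂ) * ∑ t, ε (lam (B.translate t (lact r (ract x r⁻¹)))) := fun r => by
    rw [hGlaU]
    simpa using B.card_mul_finsum_translate hl hr lam fun μ => ε (μ (lact r (ract x r⁻¹)))
  have hcard : (Nat.card laU : ℂ) * Nat.card Jrt = Fintype.card J := by
    rw [← Nat.card_eq_fintype_card, ← card_range_dual_mul_card_annihilator lam, Nat.cast_mul]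
  have hJrt : (Nat.card Jrt : ℂ) ≠ 0 := right_ne_zero_of_mul (hcard ▸ hJ)
  have hH₀card : (Nat.card H₀ : ℂ) ≠ 0 := Nat.cast_ne_zero.mpr Nat.card_pos.ne'
  have hGlaUcard : (Nat.card GlaU : ℂ) ≠ 0 := by
    rw [hGlaU]
    exact Nat.cast_ne_zero.mpr Nat.card_pos.ne'
  have htotal : (Nat.card GlaU : ℂ) * ∑ s : G, ξdot (s * (ρ h * em x) * s⁻¹) =
      (Fintype.card L : ℂ) * Fintype.card J *
        ∑ r : L, θ (r * h * r⁻¹) * ∑ᶠ μ ∈ GlaU, ε (μ (lact r (ract x r⁻¹))) := by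
    apply mul_left_cancel₀ hJ
    rw [mul_left_comm, hsum, Finset.mul_sum, ← mul_assoc, Finset.mul_sum]
    exact Finset.sum_congr rfl fun r _ => by
      linear_combination -θ (r * h * r⁻¹) * horbit r
  change ((Nat.card H₀ * Nat.card Jrt : ℕ) : ℂ)⁻¹ *
    ∑ s : G, ξdot (s * (ρ h * em x) * s⁻¹) = _
  rw [← hcard] at htotal
  push_cast
  field_simp
  linear_combination htotal
end

section
/- Let λ ∈ J*, let H₀ be a subgroup of H_{Uλ}, and let θ be the character of a complex representation of H₀. Define ξ_{θ,λ} on G_{0,λ} = H₀ ⋉ U_{λ,rt} by ξ_{θ,λ}(h(1+x)) = θ(h)·ε^{λ(x)}, and let χ''_{θ,λ} = Ind_{G_{0,λ}}^G ξ_{θ,λ}. Then for every g = h(1+x) ∈ G with h ∈ L and x ∈ J: χ''_{θ,λ}(g) = |λU|/(|H₀|·|UλU|) · Σ_{r∈L} θ̇(rhr^{-1}) · (Σ_{μ∈UλU} ε^{μ(rxr^{-1})}), where θ̇ equals θ on H₀ and 0 on L∖H₀, λU = {λu : u ∈ U}, and UλU = {uλv : u,v ∈ U}. -/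
open scoped Classical

section AlgebraGroup

variable {F J : Type} [Field F] [NonUnitalRing J] [Module F J]
  [SMulCommClass F J J] [IsScalarTower F J J]

/-- The product of the algebra group `1 + J`, written on `J`. -/
def circ (a b : J) : J := a + b + a * b

/-- The functional `x ↦ μ ((1 + b) x (1 + w))`. -/
def biTranslate (μ : Module.Dual F J) (b w : J) : Module.Dual F J where
  toFun x := μ ((x + b * x) + (x + b * x) * w)
  map_add' x y := by
    rw [← map_add]
    congr 1
    noncomm_ring
  map_smul' c x := by
    simp only [mul_smul_comm, smul_mul_assoc, ← smul_add, map_smul, RingHom.id_apply]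

theorem biTranslate_apply (μ : Module.Dual F J) (b w x : J) :
    biTranslate μ b w x = μ ((x + b * x) + (x + b * x) * w) := rfl

theorem biTranslate_zero (μ : Module.Dual F J) : biTranslate μ 0 0 = μ := by
  ext x
  simp [biTranslate_apply]

theorem biTranslate_biTranslate (μ : Module.Dual F J) (b c w d : J) :
    biTranslate (biTranslate μ b w) c d = biTranslate μ (circ b c) (circ d w) := by
  ext x
  simp only [biTranslate_apply, circ]
  congr 1
  noncomm_ring

/-- Summing over `U × U` is, up to a factor, summing over the two-sided orbit. -/
theorem card_mul_sum_biTranslate [Fintype J]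
    (hl : ∀ a : J, Function.Bijective (circ a))
    (hr : ∀ a : J, Function.Bijective fun b => circ b a)
    (μ : Module.Dual F J) (O : Finset (Module.Dual F J))
    (hO : ∀ ν, ν ∈ O ↔ ∃ b w, ν = biTranslate μ b w) (f : Module.Dual F J → ℂ) :
    (O.card : ℂ) * ∑ b : J, ∑ w : J, f (biTranslate μ b w) =
      (Fintype.card J : ℂ) * (Fintype.card J : ℂ) * ∑ ν ∈ O, f ν := by
  have base : ∀ ν ∈ O, ∑ b : J, ∑ w : J, f (biTranslate ν b w) =
      ∑ b : J, ∑ w : J, f (biTranslate μ b w) := by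
    intro ν hν
    obtain ⟨c, d, rfl⟩ := (hO ν).1 hν
    simp only [biTranslate_biTranslate]
    rw [← (hl c).sum_comp fun b => ∑ w : J, f (biTranslate μ b w)]
    exact Finset.sum_congr rfl fun b _ =>
      (hr d).sum_comp fun w => f (biTranslate μ (circ c b) w)
  have perm : ∀ b w : J, ∑ ν ∈ O, f (biTranslate ν b w) = ∑ ν ∈ O, f ν := by
    intro b w
    have inj : Function.Injective fun ν : Module.Dual F J => biTranslate ν b w := by
      obtain ⟨c, hc⟩ := (hl b).2 0
      obtain ⟨d, hd⟩ := (hr w).2 0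
      intro ν ν' h
      have h' := congrArg (fun κ => biTranslate κ c d) h
      dsimp only at hd h'
      rwa [biTranslate_biTranslate, biTranslate_biTranslate, hc, hd, biTranslate_zero,
        biTranslate_zero] at h'
    have maps : O.image (fun ν => biTranslate ν b w) = O := by
      apply Finset.eq_of_subset_of_card_le
      · intro κ hκ
        obtain ⟨ν, hν, rfl⟩ := Finset.mem_image.1 hκ
        obtain ⟨c, d, rfl⟩ := (hO ν).1 hν
        exact (hO _).2 ⟨_, _, biTranslate_biTranslate μ c b d w⟩
      · rw [Finset.card_image_of_injective _ inj]
    conv_rhs => rw [← maps]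
    rw [Finset.sum_image fun _ _ _ _ h => inj h]
  calc (O.card : ℂ) * ∑ b : J, ∑ w : J, f (biTranslate μ b w)
      = ∑ ν ∈ O, ∑ b : J, ∑ w : J, f (biTranslate ν b w) := by
        rw [Finset.sum_congr rfl base, Finset.sum_const, nsmul_eq_mul]
    _ = ∑ b : J, ∑ w : J, ∑ ν ∈ O, f (biTranslate ν b w) := by
        rw [Finset.sum_comm]
        exact Finset.sum_congr rfl fun b _ => Finset.sum_comm
    _ = _ := by
        simp only [perm, Finset.sum_const, Finset.card_univ, nsmul_eq_mul]
        ring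

/-- Averaging over `1 + J` detects membership in the right stabilizer. -/
theorem sum_addChar_eq_ite [Fintype J] (ε : AddChar F ℂ) (hε : ε ≠ 1)
    (μ : Module.Dual F J) (z : J) :
    ∑ w : J, ε (μ (z + z * w)) =
      (Fintype.card J : ℂ) * if ∀ w, μ (z * w) = 0 then ε (μ z) else 0 := by
  simp only [map_add, AddChar.map_add_eq_mul, ← Finset.mul_sum]
  split_ifs with h
  · simp [h, mul_comm]
  · push Not at h
    obtain ⟨w₀, hw₀⟩ := h
    obtain ⟨t, ht⟩ := (AddChar.ne_one_iff).1 hε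
    let ψ : AddChar J ℂ := ε.compAddMonoidHom
      ((μ : J →ₗ[F] F).toAddMonoidHom.comp (AddMonoidHom.mulLeft z))
    have hψ : ψ ≠ 0 := by
      rw [AddChar.ne_zero_iff]
      refine ⟨(t / μ (z * w₀)) • w₀, ?_⟩
      change ε (μ (z * ((t / μ (z * w₀)) • w₀))) ≠ 1
      rwa [mul_smul_comm, map_smul, smul_eq_mul, div_mul_cancel₀ _ hw₀]
    have hsum : ∑ w : J, ε (μ (z * w)) = 0 := (AddChar.sum_eq_zero_iff_ne_zero (ψ := ψ)).2 hψ
    rw [hsum]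
    simp

/-- The right orbit of a functional is counted by the index of its stabilizer. -/
theorem card_orbit_mul_card_stabilizer [Fintype J] (μ : Module.Dual F J) :
    Nat.card {ν : Module.Dual F J | ∃ z : J, ∀ x : J, ν x = μ (x + z * x)} *
      Nat.card {z : J | ∀ w : J, μ (z * w) = 0} = Nat.card J := by
  let φ : J →ₗ[F] Module.Dual F J := (LinearMap.mul F J).compr₂ μ
  have hφ : ∀ z x, φ z x = μ (z * x) := fun _ _ => rfl
  have hker : Nat.card {z : J | ∀ w : J, μ (z * w) = 0} = Nat.card (LinearMap.ker φ) := by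
    congr 2
    ext z
    simp [LinearMap.ext_iff, hφ]
  have hrange : Nat.card {ν : Module.Dual F J | ∃ z : J, ∀ x : J, ν x = μ (x + z * x)} =
      Nat.card (LinearMap.range φ) := by
    refine Nat.card_congr ((Equiv.subRight μ).subtypeEquiv fun ν => ?_)
    simp only [Set.mem_ofPred_eq, LinearMap.mem_range, LinearMap.ext_iff, Equiv.subRight_apply,
      map_add, eq_sub_iff_add_eq']
    exact exists_congr fun z => forall_congr' fun x => eq_comm
  rw [hker, hrange, ← Nat.card_congr φ.quotKerEquivRange.toEquiv, mul_comm]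
  exact (Submodule.card_eq_card_quotient_mul_card (LinearMap.ker φ)).symm

/-- The sum over `1 + J` of the conjugates of the linear character attached to `μ`. -/
theorem card_mul_sum_conj [Fintype J] (hl : ∀ a : J, Function.Bijective (circ a))
    (ε : AddChar F ℂ) (hε : ε ≠ 1) (μ : Module.Dual F J)
    (σ : J → J) (hσ : Function.Bijective σ)
    (hfix : ∀ a w : J, μ (σ a + σ a * w) = μ (a + a * w))
    (y : J) (ζ : J → J) (hζ : ∀ a, circ (ζ a) a = circ (σ a) y) :
    (Fintype.card J : ℂ) *
        ∑ a : J, (if ∀ w, μ (ζ a * w) = 0 then ε (μ (ζ a)) else 0) =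
      ∑ b : J, ∑ w : J, ε (biTranslate μ b w y) := by
  rw [Finset.mul_sum, ← hσ.sum_comp fun b => ∑ w : J, ε (biTranslate μ b w y)]
  refine Finset.sum_congr rfl fun a _ => ?_
  rw [← sum_addChar_eq_ite ε hε, ← (hl a).sum_comp fun w => ε (μ (ζ a + ζ a * w))]
  refine Finset.sum_congr rfl fun w _ => congrArg ε ?_
  have hza : ζ a + ζ a * a = σ a - a + (y + σ a * y) := by
    have := hζ a
    simp only [circ] at this
    rw [← sub_eq_zero] at this ⊢
    rw [← this]
    abel
  have expand : ζ a + ζ a * circ a w =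
      (σ a + σ a * w) - (a + a * w) + ((y + σ a * y) + (y + σ a * y) * w) := by
    calc ζ a + ζ a * circ a w = (ζ a + ζ a * a) + (ζ a + ζ a * a) * w := by
          simp only [circ]
          noncomm_ring
      _ = _ := by
          rw [hza]
          noncomm_ring
  rw [expand, map_add, map_sub, hfix, sub_self, zero_add, biTranslate_apply]

end AlgebraGroup

theorem stmt_6
    (F : Type) [Field F] [Fintype F]
    (J : Type) [NonUnitalRing J] [Module F J]
    [SMulCommClass F J J] [IsScalarTower F J J] [Fintype J]
    (hnil : ∃ N : ℕ, ∀ x : ℕ → J,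
      (List.range N).foldr (fun i acc => x i * acc) (x N) = 0)
    (L : Type) [Group L] [Fintype L]
    (lact : L → J → J) (ract : J → L → J)
    (hlactlin : ∀ h : L, IsLinearMap F (lact h))
    (hractlin : ∀ h : L, IsLinearMap F (fun x => ract x h))
    (hlact_one : ∀ x : J, lact 1 x = x)
    (hlact_mul : ∀ h k : L, ∀ x : J, lact (h * k) x = lact h (lact k x))
    (hract_one : ∀ x : J, ract x 1 = x)
    (hract_mul : ∀ h k : L, ∀ x : J, ract x (h * k) = ract (ract x h) k)
    (hcomm : ∀ h k : L, ∀ x : J, ract (lact h x) k = lact h (ract x k))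
    (hlmul : ∀ h : L, ∀ x y : J, lact h (x * y) = lact h x * y)
    (hrmul : ∀ h : L, ∀ x y : J, ract (x * y) h = x * ract y h)
    (hmid : ∀ h : L, ∀ x y : J, x * lact h y = ract x h * y)
    (G : Type) [Group G] [Fintype G]
    (ρ : L →* G) (em : J → G)
    (hem : ∀ x y : J, em x * em y = em (x + y + x * y))
    (hsplit : Function.Bijective (fun p : L × J => ρ p.1 * em p.2))
    (hconj : ∀ (h : L) (x : J), ρ h * em x * (ρ h)⁻¹ = em (lact h (ract x h⁻¹)))
    (ε : AddChar F ℂ) (hε : ε ≠ 1)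
    (lam : Module.Dual F J)
    (H₀ : Subgroup L)
    (hH₀ : ∀ h ∈ H₀, ∀ μ : Module.Dual F J,
      (∃ w : J, ∀ x : J, μ x = lam (x + x * w)) →
      ∀ x : J, μ (ract (lact h⁻¹ x) h) = μ x)
    (θ : L → ℂ)
    (hθ : ∃ W : FDRep ℂ ↥H₀, ∀ h : ↥H₀, θ ↑h = W.character h)
    (hθ0 : ∀ h : L, h ∉ H₀ → θ h = 0) :
    let dec : G → L × J :=
      @Function.invFun (L × J) G ⟨(1, 0)⟩ fun p : L × J => ρ p.1 * em p.2
    let Jrt : Set J := {z : J | ∀ w : J, lam (z * w) = 0}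
    let UlaU : Set (Module.Dual F J) :=
      {μ | ∃ (w z : J), ∀ x : J,
        μ x = lam ((x + z * x) + (x + z * x) * w)}
    let laU : Set (Module.Dual F J) :=
      {μ | ∃ z : J, ∀ x : J, μ x = lam (x + z * x)}
    let ξdot : G → ℂ := fun s =>
      if (dec s).1 ∈ H₀ ∧ (dec s).2 ∈ Jrt then θ (dec s).1 * ε (lam (dec s).2)
      else 0
    let χ : G → ℂ := fun g =>
      ((Nat.card ↥H₀ * Nat.card ↥Jrt : ℕ) : ℂ)⁻¹ * ∑ s : G, ξdot (s * g * s⁻¹)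
    ∀ (h : L) (x : J),
      χ (ρ h * em x) =
        (Nat.card ↥laU : ℂ) / ((Nat.card ↥H₀ : ℂ) * (Nat.card ↥UlaU : ℂ)) *
          ∑ r : L, θ (r * h * r⁻¹) *
            ∑ᶠ μ ∈ UlaU, ε (μ (lact r (ract x r⁻¹))) := by
  intro dec Jrt UlaU laU ξdot χ h x
  have em_inj : Function.Injective em := by
    intro a b hab
    have := @hsplit.1 (1, a) (1, b) (by simp [hab])
    exact (Prod.ext_iff.1 this).2
  have hem' : ∀ a b, em a * em b = em (circ a b) := hem
  have hl : ∀ a : J, Function.Bijective (circ a) := fun a =>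
    Finite.injective_iff_bijective.1 fun b c hbc => em_inj <| by
      simpa [← hem'] using congrArg em hbc
  have hr : ∀ a : J, Function.Bijective fun b => circ b a := fun a =>
    Finite.injective_iff_bijective.1 fun b c hbc => em_inj <| by
      simpa [← hem'] using congrArg em hbc
  let conj : L → J → J := fun r a => lact r (ract a r⁻¹)
  have hconj' : ∀ r a, em (conj r a) = ρ r * em a * (ρ r)⁻¹ := fun r a => (hconj r a).symm
  have conj_bij : ∀ r, Function.Bijective (conj r) := fun r =>
    Finite.injective_iff_bijective.1 fun b c hbc => em_inj <| by
      simpa [hconj'] using congrArg em hbc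
  have hdec : ∀ k z, dec (ρ k * em z) = (k, z) := fun k z => by
    have hinv := @Function.leftInverse_invFun (L × J) G ⟨(1, 0)⟩ _ hsplit.1
    exact hinv (k, z)
  have : Finite (Module.Dual F J) := DFunLike.finite _
  have hUfin : UlaU.Finite := Set.toFinite _
  have hO : ∀ ν, ν ∈ hUfin.toFinset ↔ ∃ b w, ν = biTranslate lam b w := by
    intro ν
    rw [Set.Finite.mem_toFinset]
    simp only [UlaU, Set.mem_ofPred_eq, LinearMap.ext_iff, biTranslate_apply]
    exact exists_comm
  have hUcard : Nat.card UlaU = hUfin.toFinset.card := Nat.card_eq_card_finite_toFinset hUfin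
  have hUpos : (hUfin.toFinset.card : ℂ) ≠ 0 := by
    rw [Nat.cast_ne_zero]
    exact Finset.card_ne_zero_of_mem ((hO _).2 ⟨0, 0, rfl⟩)
  have hJpos : (Fintype.card J : ℂ) ≠ 0 := Nat.cast_ne_zero.2 Fintype.card_ne_zero
  have hcard : (Nat.card laU : ℂ) * (Nat.card Jrt : ℂ) = Fintype.card J := by
    rw [← Nat.card_eq_fintype_card]
    exact_mod_cast card_orbit_mul_card_stabilizer lam
  have hJrt : (Nat.card Jrt : ℂ) ≠ 0 := by
    intro h0
    rw [h0, mul_zero] at hcard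
    exact hJpos hcard.symm
  have hH : (Nat.card H₀ : ℂ) ≠ 0 := Nat.cast_ne_zero.2 Nat.card_pos.ne'
  have inner : ∀ r : L, (hUfin.toFinset.card : ℂ) *
      ∑ a : J, ξdot (em a * ρ r * (ρ h * em x) * (em a * ρ r)⁻¹) =
      (Fintype.card J : ℂ) * (θ (r * h * r⁻¹) * ∑ ν ∈ hUfin.toFinset, ε (ν (conj r x))) := by
    intro r
    set k := r * h * r⁻¹ with hk
    choose ζ hζ using fun a => (hr a).2 (circ (conj k⁻¹ a) (conj r x))
    have hval : ∀ a, em a * ρ r * (ρ h * em x) * (em a * ρ r)⁻¹ = ρ k * em (ζ a) := by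
      intro a
      have h1 : em (ζ a) * em a = em (conj k⁻¹ a) * em (conj r x) := by
        rw [hem', hem']
        exact congrArg em (hζ a)
      rw [eq_mul_inv_of_mul_eq h1, hconj', hconj', hk]
      simp only [map_mul, map_inv]
      group
    simp only [hval, ξdot, hdec]
    by_cases hkH : k ∈ H₀
    · have hfix : ∀ a w : J, lam (conj k⁻¹ a + conj k⁻¹ a * w) = lam (a + a * w) := by
        intro a w
        have := hH₀ k hkH (biTranslate lam 0 w)
          ⟨w, fun y => by simp [biTranslate_apply]⟩ a
        simpa [biTranslate_apply, hcomm, conj] using this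
      have hsum := card_mul_sum_conj hl ε hε lam (conj k⁻¹) (conj_bij _) hfix (conj r x) ζ hζ
      have horb := card_mul_sum_biTranslate hl hr lam hUfin.toFinset hO
        fun ν => ε (ν (conj r x))
      have hfactor : ∑ a : J, (if k ∈ H₀ ∧ ζ a ∈ Jrt then θ k * ε (lam (ζ a)) else 0) =
          θ k * ∑ a : J, (if ∀ w, lam (ζ a * w) = 0 then ε (lam (ζ a)) else 0) := by
        rw [Finset.mul_sum]
        refine Finset.sum_congr rfl fun a _ => ?_
        simp only [hkH, true_and, mul_ite, mul_zero]
        rfl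
      rw [hfactor]
      apply mul_left_cancel₀ hJpos
      rw [← hsum] at horb
      linear_combination θ k * horb
    · simp [hkH, hθ0 k hkH]
  have hsumG : ∑ s : G, ξdot (s * (ρ h * em x) * s⁻¹) =
      ∑ r : L, ∑ a : J, ξdot (em a * ρ r * (ρ h * em x) * (em a * ρ r)⁻¹) := by
    rw [← hsplit.sum_comp fun s => ξdot (s * (ρ h * em x) * s⁻¹), Fintype.sum_prod_type]
    refine Finset.sum_congr rfl fun r _ => ?_
    rw [← (conj_bij r).sum_comp
      fun a => ξdot (em a * ρ r * (ρ h * em x) * (em a * ρ r)⁻¹)]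
    refine Finset.sum_congr rfl fun a _ => ?_
    rw [hconj', inv_mul_cancel_right]
  have hfin : ∀ r : L, ∑ᶠ μ ∈ UlaU, ε (μ (lact r (ract x r⁻¹))) =
      ∑ ν ∈ hUfin.toFinset, ε (ν (conj r x)) := fun r =>
    finsum_mem_eq_finite_toFinset_sum _ hUfin
  have htotal : (hUfin.toFinset.card : ℂ) * ∑ s : G, ξdot (s * (ρ h * em x) * s⁻¹) =
      (Fintype.card J : ℂ) *
        ∑ r : L, θ (r * h * r⁻¹) * ∑ ν ∈ hUfin.toFinset, ε (ν (conj r x)) := by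
    rw [hsumG, Finset.mul_sum, Finset.mul_sum]
    exact Finset.sum_congr rfl fun r _ => inner r
  simp only [χ, hfin, hUcard]
  rw [← hcard] at htotal
  push_cast
  field_simp
  linear_combination htotal
end

section
/- For every λ ∈ J*, the group L acts transitively by right multiplication on the set of G×U orbits contained in GλG: for every μ ∈ GλG = {gλg' : g,g' ∈ G} there exists r ∈ L with GμU = (GλU)r. Consequently the number of G×U orbits contained in GλG equals |GλG|/|GλU|, and the stabilizer in L of the set GλU under this action has exactly |L|·|GλU|/|GλG| elements. -/
open scoped Classical

open scoped Pointwise in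
/-- If a group permutes the blocks of a partition of a finite set, the blocks in one orbit are
equinumerous and partition their union. -/
theorem card_orbit_block_mul_card {L X : Type*} [Group L] [Finite X] [MulAction L X]
    {C : X → Set X} (hself : ∀ x, x ∈ C x) (heq : ∀ x, ∀ y ∈ C x, C y = C x)
    (hsmul : ∀ (r : L) x, r • C x = C (r • x)) (a : X) :
    Nat.card (MulAction.orbit L (C a)) * Nat.card (C a) =
      Nat.card {y | ∃ r : L, y ∈ C (r • a)} := by
  have hcard (S : MulAction.orbit L (C a)) : Nat.card (S : Set X) = Nat.card (C a) := by
    obtain ⟨_, r, rfl⟩ := S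
    exact Set.natCard_smul_set r (C a)
  have hblock (S : MulAction.orbit L (C a)) (y : X) (hy : y ∈ (S : Set X)) : C y = S := by
    obtain ⟨_, r, rfl⟩ := S
    simp only [hsmul] at hy ⊢
    exact heq _ _ hy
  have e : (Σ S : MulAction.orbit L (C a), (S : Set X)) ≃ {y | ∃ r : L, y ∈ C (r • a)} :=
    { toFun := fun p => ⟨p.2, by
        obtain ⟨⟨_, r, rfl⟩, y, hy⟩ := p
        exact ⟨r, by simpa only [hsmul] using hy⟩⟩
      invFun := fun y => ⟨⟨C y, by
        obtain ⟨y, r, hy⟩ := y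
        exact ⟨r, by simp only [hsmul, heq _ _ hy]⟩⟩, y, hself y⟩
      left_inv := by
        rintro ⟨⟨S, hS⟩, y, hy⟩
        obtain rfl : C y = S := hblock ⟨S, hS⟩ y hy
        rfl
      right_inv := fun _ => rfl }
  have := Fintype.ofFinite (MulAction.orbit L (C a))
  rw [← Nat.card_congr e, Nat.card_sigma, Finset.sum_congr rfl fun S _ => hcard S]
  simp

/-- In a nilpotent ring every equation `y + z * y = b` is solvable when the ring is finite. -/
theorem exists_add_mul_eq_of_nilpotent {J : Type*} [NonUnitalRing J] [Finite J]
    (hnil : ∃ N : ℕ, ∀ x : ℕ → J,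
      (List.range N).foldr (fun i acc => x i * acc) (x N) = 0) (z b : J) :
    ∃ y, y + z * y = b := by
  obtain ⟨N, hN⟩ := hnil
  refine Finite.surjective_of_injective (f := fun y => y + z * y) (fun y y' h => ?_) b
  have hfix : -z * (y - y') = y - y' := by
    have h' : y + z * y = y' + z * y' := h
    rw [neg_mul, mul_sub, neg_sub, sub_eq_sub_iff_add_eq_add, add_comm _ y', ← h', add_comm]
  have hfold (l : List ℕ) (hl : ∀ i ∈ l, i < N) :
      l.foldr (fun i acc => (if i < N then -z else y - y') * acc) (y - y') = y - y' := by
    induction l with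
    | nil => rfl
    | cons i l ih =>
      rw [List.foldr_cons, ih fun j hj => hl j (List.mem_cons_of_mem _ hj),
        if_pos (hl i List.mem_cons_self), hfix]
  have := hN fun i => if i < N then -z else y - y'
  rw [if_neg (lt_irrefl N), hfold _ fun i hi => List.mem_range.1 hi] at this
  exact sub_eq_zero.1 this

/-- In a nilpotent ring every equation `y + y * z = b` is solvable when the ring is finite. -/
theorem exists_add_mul_eq_of_nilpotent_right {J : Type*} [NonUnitalRing J] [Finite J]
    (hnil : ∃ N : ℕ, ∀ x : ℕ → J,
      (List.range N).foldr (fun i acc => x i * acc) (x N) = 0) (z b : J) :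
    ∃ y, y + y * z = b := by
  obtain ⟨N, hN⟩ := hnil
  refine Finite.surjective_of_injective (f := fun y => y + y * z) (fun y y' h => ?_) b
  have hfix : (y - y') * -z = y - y' := by
    have h' : y + y * z = y' + y' * z := h
    rw [mul_neg, sub_mul, neg_sub, sub_eq_sub_iff_add_eq_add, add_comm _ y', ← h', add_comm]
  have hfold (l : List ℕ) :
      (y - y') * l.foldr (fun _ acc => -z * acc) (-z) = y - y' := by
    induction l with
    | nil => exact hfix
    | cons i l ih => rw [List.foldr_cons, ← mul_assoc, hfix, ih]
  have := hfold (List.range N)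
  rw [hN fun _ => -z, mul_zero] at this
  exact sub_eq_zero.1 this.symm

open scoped Pointwise in
theorem stmt_7
    (F : Type) [Field F] [Fintype F]
    (J : Type) [NonUnitalRing J] [Module F J]
    [SMulCommClass F J J] [IsScalarTower F J J] [Fintype J]
    (hnil : ∃ N : ℕ, ∀ x : ℕ → J,
      (List.range N).foldr (fun i acc => x i * acc) (x N) = 0)
    (L : Type) [Group L] [Fintype L]
    (lact : L → J → J) (ract : J → L → J)
    (hlactlin : ∀ h : L, IsLinearMap F (lact h))
    (hractlin : ∀ h : L, IsLinearMap F (fun x => ract x h))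
    (hlact_one : ∀ x : J, lact 1 x = x)
    (hlact_mul : ∀ h k : L, ∀ x : J, lact (h * k) x = lact h (lact k x))
    (hract_one : ∀ x : J, ract x 1 = x)
    (hract_mul : ∀ h k : L, ∀ x : J, ract x (h * k) = ract (ract x h) k)
    (hcomm : ∀ h k : L, ∀ x : J, ract (lact h x) k = lact h (ract x k))
    (hlmul : ∀ h : L, ∀ x y : J, lact h (x * y) = lact h x * y)
    (hrmul : ∀ h : L, ∀ x y : J, ract (x * y) h = x * ract y h)
    (hmid : ∀ h : L, ∀ x y : J, x * lact h y = ract x h * y)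
    (lam : Module.Dual F J) :
    let GlaUof : Module.Dual F J → Set (Module.Dual F J) := fun l =>
      {μ | ∃ (k : L) (w z : J), ∀ x : J,
        μ x = l (ract (x + z * x) k + ract (x + z * x) k * w)}
    let GlaG : Set (Module.Dual F J) :=
      {μ | ∃ (k : L) (w : J) (k' : L) (w' : J), ∀ x : J,
        μ x = lam (ract (lact k' (x + w' * x)) k +
          ract (lact k' (x + w' * x)) k * w)}
    let rTrans : L → Set (Module.Dual F J) → Set (Module.Dual F J) := fun r S =>
      {ν | ∃ σ ∈ S, ∀ x : J, ν x = σ (lact r x)}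
    (∀ μ ∈ GlaG, ∃ r : L, GlaUof μ = rTrans r (GlaUof lam)) ∧
    Nat.card ↥{S : Set (Module.Dual F J) | ∃ μ ∈ GlaG, S = GlaUof μ} *
        Nat.card ↥(GlaUof lam) = Nat.card ↥GlaG ∧
    Nat.card ↥{r : L | rTrans r (GlaUof lam) = GlaUof lam} * Nat.card ↥GlaG =
      Fintype.card L * Nat.card ↥(GlaUof lam) := by
  intro GlaUof GlaG rTrans
  have hladd (h : L) (x y : J) : lact h (x + y) = lact h x + lact h y := (hlactlin h).map_add x y
  have hradd (h : L) (x y : J) : ract (x + y) h = ract x h + ract y h := (hractlin h).map_add x y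
  have hlinv (h : L) (x : J) : lact h⁻¹ (lact h x) = x := by
    rw [← hlact_mul, inv_mul_cancel, hlact_one]
  have hrinv (h : L) (x : J) : ract (ract x h) h⁻¹ = x := by
    rw [← hract_mul, mul_inv_cancel, hract_one]
  have hrefl (l : Module.Dual F J) : l ∈ GlaUof l :=
    ⟨1, 0, 0, fun x => by simp [hract_one]⟩
  have htrans {l μ ν : Module.Dual F J} (h₁ : μ ∈ GlaUof l) (h₂ : ν ∈ GlaUof μ) :
      ν ∈ GlaUof l := by
    obtain ⟨k, w, z, h₁⟩ := h₁
    obtain ⟨k', w', z', h₂⟩ := h₂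
    refine ⟨k' * k, lact k⁻¹ (ract w' k) + w + lact k⁻¹ (ract w' k) * w, z + z' + z * z',
      fun x => ?_⟩
    rw [h₂, h₁]
    congr 1
    simp only [hract_mul, hradd, hrmul, mul_add, add_mul, mul_assoc, ← hlmul, hmid, hrinv]
    abel
  have hsymm {l μ : Module.Dual F J} (h : μ ∈ GlaUof l) : l ∈ GlaUof μ := by
    obtain ⟨k, w, z, h⟩ := h
    obtain ⟨z', hz'⟩ := exists_add_mul_eq_of_nilpotent hnil z (-z)
    obtain ⟨v, hv⟩ := exists_add_mul_eq_of_nilpotent_right hnil w (-w)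
    have hright (y : J) : y + z' * y + z * (y + z' * y) = y := by
      have : (z' + z * z' + z) * y = 0 := by rw [hz', neg_add_cancel, zero_mul]
      calc y + z' * y + z * (y + z' * y) = y + (z' + z * z' + z) * y := by
            simp only [mul_add, add_mul, mul_assoc]
            abel
        _ = y := by rw [this, add_zero]
    have hleft (y : J) : y + y * v + (y + y * v) * w = y := by
      have : y * (v + v * w + w) = 0 := by rw [hv, neg_add_cancel, mul_zero]
      calc y + y * v + (y + y * v) * w = y + y * (v + v * w + w) := by
            simp only [mul_add, add_mul, mul_assoc]
            abel
        _ = y := by rw [this, add_zero]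
    refine ⟨k⁻¹, lact k (ract v k⁻¹), z', fun x => ?_⟩
    have hk (y : J) : ract (ract y k⁻¹ + ract y k⁻¹ * lact k (ract v k⁻¹)) k = y + y * v := by
      rw [hmid, ← hract_mul, inv_mul_cancel, hract_one, hradd, hrmul, ← hract_mul, ← hract_mul,
        inv_mul_cancel, hract_one, hract_one]
    have hz (y c : J) : ract y k⁻¹ + ract y k⁻¹ * c + z * (ract y k⁻¹ + ract y k⁻¹ * c) =
        ract (y + z * y) k⁻¹ + ract (y + z * y) k⁻¹ * c := by
      rw [hradd, hrmul, mul_add, add_mul, mul_assoc]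
      abel
    rw [h, hz, hright, hk, hleft]
  have hclass (l μ : Module.Dual F J) (h : μ ∈ GlaUof l) : GlaUof μ = GlaUof l :=
    Set.Subset.antisymm (fun _ => htrans h) fun _ => htrans (hsymm h)
  let _ : MulAction L (Module.Dual F J) :=
    { smul := fun r l => l.comp (hlactlin r⁻¹).mk'
      one_smul := fun l => LinearMap.ext fun x => by
        change l (lact 1⁻¹ x) = l x
        rw [inv_one, hlact_one]
      mul_smul := fun r s l => LinearMap.ext fun x => by
        change l (lact (r * s)⁻¹ x) = l (lact s⁻¹ (lact r⁻¹ x))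
        rw [mul_inv_rev, hlact_mul] }
  have hsmul_apply (r : L) (l : Module.Dual F J) (x : J) : (r • l) x = l (lact r⁻¹ x) := rfl
  have hsmul_mem {r : L} {l μ : Module.Dual F J} (h : μ ∈ GlaUof l) : r • μ ∈ GlaUof (r • l) := by
    obtain ⟨k, w, z, h⟩ := h
    refine ⟨k, w, lact r (ract z r⁻¹), fun x => ?_⟩
    have hz : lact r⁻¹ (lact r (ract z r⁻¹) * x) = z * lact r⁻¹ x := by
      rw [hlmul, hlinv, hmid]
    rw [hsmul_apply, hsmul_apply, h, hladd, hlmul, ← hcomm, hladd, hz]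
  have hsmul (r : L) (l : Module.Dual F J) : r • GlaUof l = GlaUof (r • l) := by
    refine Set.Subset.antisymm ?_ fun μ h => ?_
    · rintro _ ⟨μ, h, rfl⟩
      exact hsmul_mem h
    · refine Set.mem_smul_set_iff_inv_smul_mem.2 ?_
      simpa using hsmul_mem (r := r⁻¹) h
  have hrTrans (r : L) (S : Set (Module.Dual F J)) : rTrans r S = r⁻¹ • S := by
    ext ν
    refine exists_congr fun σ => and_congr_right fun _ => ?_
    rw [eq_comm, LinearMap.ext_iff]
    simp only [hsmul_apply, inv_inv]
  have hGlaG : GlaG = {μ | ∃ r : L, μ ∈ GlaUof (r • lam)} := by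
    ext μ
    constructor
    · rintro ⟨k, w, k', w', h⟩
      refine ⟨k'⁻¹, k, w, w', fun x => ?_⟩
      rw [h, hsmul_apply, inv_inv, hladd k' (ract _ _), hlmul, hcomm]
    · rintro ⟨r, k, w, z, h⟩
      refine ⟨k, w, r⁻¹, z, fun x => ?_⟩
      rw [h, hsmul_apply, hladd r⁻¹ (ract _ _), hlmul, hcomm]
  have horbit : {S | ∃ μ ∈ GlaG, S = GlaUof μ} = MulAction.orbit L (GlaUof lam) := by
    ext S
    rw [hGlaG]
    constructor
    · rintro ⟨μ, ⟨r, hμ⟩, rfl⟩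
      exact ⟨r, by simp only [hsmul, hclass _ _ hμ]⟩
    · rintro ⟨r, rfl⟩
      exact ⟨r • lam, ⟨r, hrefl _⟩, hsmul r lam⟩
  have hstab : {r : L | rTrans r (GlaUof lam) = GlaUof lam} =
      MulAction.stabilizer L (GlaUof lam) := by
    ext r
    rw [Set.mem_ofPred_eq, hrTrans, SetLike.mem_coe, ← inv_mem_iff, MulAction.mem_stabilizer_iff]
  have : Finite (Module.Dual F J) := DFunLike.finite _
  have hcard := card_orbit_block_mul_card hrefl hclass hsmul lam
  rw [← hGlaG] at hcard
  refine ⟨fun μ hμ => ?_, by rw [horbit, hcard], ?_⟩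
  · rw [hGlaG] at hμ
    obtain ⟨r, hμ⟩ := hμ
    exact ⟨r⁻¹, by rw [hrTrans, inv_inv, hsmul, hclass _ _ hμ]⟩
  · have hos := Nat.card_congr (MulAction.orbitProdStabilizerEquivGroup L (GlaUof lam))
    rw [Nat.card_prod] at hos
    rw [hstab, ← hcard, ← Nat.card_eq_fintype_card, ← hos]
    change Nat.card (MulAction.stabilizer L (GlaUof lam)) * _ = _
    ring
end

section
/- Let λ ∈ J*. Then H_{GλG} is a normal subgroup of L. Let θ be the character of a complex representation of H_{GλG} satisfying θ(rhr^{-1}) = θ(h) for all h ∈ H_{GλG} and r ∈ L, and let χ_α = Ind_{G_{0,λ}}^G (Σ_{p∈L} ξ_{θ,pλ}), where G_{0,λ} = H_{GλG} ⋉ U_{λ,rt} and ξ_{θ,pλ}(h(1+x)) = θ(h)·ε^{(pλ)(x)}. Then for every g = h(1+x) ∈ G with h ∈ L and x ∈ J: χ_α(g) = (|L|²·|λU|)/(|H_{GλG}|·|GλG|) · θ̇(h) · Σ_{μ∈GλG} ε^{μ(x)}, where θ̇ equals θ on H_{GλG} and 0 on L∖H_{GλG}. -/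
open scoped Classical

/-- A group `G` that is the semidirect product of `L` and the algebra group `1 + J`, with
the two-sided action of `G` on `J`. -/
structure AlgebraGroupExtension (F J L G : Type) [Field F] [NonUnitalRing J] [Module F J]
    [Group L] [Group G] where
  left : G → Module.End F J
  right : G → Module.End F J
  rho : L →* G
  em : J → G
  left_one : ∀ x, left 1 x = x
  left_mul : ∀ g k x, left (g * k) x = left g (left k x)
  right_one : ∀ x, right 1 x = x
  right_mul : ∀ g k x, right (g * k) x = right k (right g x)
  right_left : ∀ g k x, right k (left g x) = left g (right k x)
  mul_left : ∀ g x y, x * left g y = right g x * y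
  left_em : ∀ w x, left (em w) x = x + w * x
  right_em : ∀ w x, right (em w) x = x + x * w
  em_mul : ∀ x y, em x * em y = em (x + y + x * y)
  bijective : Function.Bijective fun p : L × J => rho p.1 * em p.2
  conj_em : ∀ h x, rho h * em x * (rho h)⁻¹ = em (left (rho h) (right (rho h)⁻¹ x))

namespace AlgebraGroupExtension

section Sums

/-- A map on a finite group whose fibres are permuted by left translation is equidistributed on
its range. -/
lemma card_range_mul_sum {K X : Type} [Group K] [Fintype K] (φ : K → X)
    (hφ : ∀ a b c, φ a = φ b → φ (c * a) = φ (c * b)) (f : X → ℂ) :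
    (Nat.card (Set.range φ) : ℂ) * ∑ k, f (φ k) =
      Fintype.card K * ∑ᶠ x ∈ Set.range φ, f x := by
  have hfib (a : K) : (Finset.univ.filter fun k => φ k = φ a).card =
      (Finset.univ.filter fun k => φ k = φ 1).card := by
    refine Finset.card_bij (fun k _ => a⁻¹ * k) ?_ ?_ ?_
    · intro k hk
      simpa using hφ k a a⁻¹ (by simpa using hk)
    · intro k _ l _ hkl
      simpa using hkl
    · intro k hk
      refine ⟨a * k, ?_, by simp⟩
      simpa using hφ k 1 a (by simpa using hk)
  have hsum (f : X → ℂ) : ∑ k, f (φ k) =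
      ((Finset.univ.filter fun k => φ k = φ 1).card : ℂ) *
        ∑ x ∈ Finset.univ.image φ, f x := by
    rw [Finset.mul_sum, Finset.sum_comp]
    refine Finset.sum_congr rfl fun x hx => ?_
    obtain ⟨a, -, rfl⟩ := Finset.mem_image.1 hx
    rw [hfib, nsmul_eq_mul]
  have hrange : Set.range φ = (Finset.univ.image φ : Finset X) := by simp
  have hcard := hsum fun _ => 1
  simp only [Finset.sum_const, Finset.card_univ, nsmul_eq_mul, mul_one] at hcard
  have hnat : Nat.card (Set.range φ) = (Finset.univ.image φ).card := by
    rw [hrange, Nat.card_coe_set_eq, Set.ncard_coe_finset]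
  rw [hnat, hsum, hcard, hrange, finsum_mem_coe_finset]
  ring

lemma sum_addChar_linear {F V : Type} [Field F] [AddCommGroup V] [Module F V]
    [Fintype V] (ε : AddChar F ℂ) (hε : ε ≠ 1) (ν : Module.Dual F V) :
    ∑ w, ε (ν w) = if ∀ w, ν w = 0 then (Fintype.card V : ℂ) else 0 := by
  split_ifs with h
  · simp [h]
  · have hne : ε.compAddMonoidHom ν.toAddMonoidHom ≠ 0 := by
      push Not at h
      obtain ⟨w, hw⟩ := h
      intro h0
      refine hε (DFunLike.ext _ _ fun t => ?_)
      have := DFunLike.congr_fun h0 ((t * (ν w)⁻¹) • w)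
      simpa [hw] using this
    simpa using AddChar.sum_eq_zero_of_ne_one hne

end Sums

variable {F J L G : Type} [Field F] [NonUnitalRing J] [Module F J] [Group L] [Group G]
  (E : AlgebraGroupExtension F J L G)

/-- The functional `x ↦ μ (k x g)`. -/
def biact (g k : G) (μ : Module.Dual F J) : Module.Dual F J :=
  μ ∘ₗ E.left k ∘ₗ E.right g

@[simp] lemma biact_apply (g k : G) (μ : Module.Dual F J) (x : J) :
    E.biact g k μ x = μ (E.left k (E.right g x)) := rfl

lemma biact_biact (g k g' k' : G) (μ : Module.Dual F J) :
    E.biact g k (E.biact g' k' μ) = E.biact (g * g') (k' * k) μ := by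
  ext x
  simp [E.left_mul, E.right_mul, E.right_left]

/-- The two-sided orbit of a functional. -/
def orbit (μ : Module.Dual F J) : Set (Module.Dual F J) :=
  Set.range fun p : G × G => E.biact p.1 p.2 μ

lemma biact_mem_orbit {μ ν : Module.Dual F J} (h : ν ∈ E.orbit μ) (g k : G) :
    E.biact g k ν ∈ E.orbit μ := by
  obtain ⟨⟨g', k'⟩, rfl⟩ := h
  exact ⟨(g * g', k' * k), (E.biact_biact g k g' k' μ).symm⟩

lemma card_orbit_mul_sum [Fintype G] (lam : Module.Dual F J) (f : Module.Dual F J → ℂ) :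
    (Nat.card (E.orbit lam) : ℂ) * ∑ s, ∑ q, f (E.biact q s lam) =
      (Fintype.card G : ℂ) ^ 2 * ∑ᶠ μ ∈ E.orbit lam, f μ := by
  let φ : G × G → Module.Dual F J := fun p => E.biact p.1 p.2⁻¹ lam
  have hr : E.orbit lam = Set.range φ := by
    ext μ
    constructor
    · rintro ⟨p, rfl⟩
      exact ⟨(p.1, p.2⁻¹), by simp [φ]⟩
    · rintro ⟨p, rfl⟩
      exact ⟨(p.1, p.2⁻¹), rfl⟩
  have key := card_range_mul_sum φ (fun a b c h => by
    have := congrArg (E.biact c.1 c.2⁻¹) h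
    simpa only [φ, biact_biact, Prod.fst_mul, Prod.snd_mul, mul_inv_rev] using this) f
  rw [← hr, Fintype.sum_prod_type, Finset.sum_comm, ← Equiv.sum_comp (Equiv.inv G)] at key
  simpa [φ, pow_two] using key

/-- The elements of `L` fixing the two-sided orbit of `lam` pointwise under conjugation. -/
def fixer (lam : Module.Dual F J) : Subgroup L where
  carrier := {r | ∀ μ ∈ E.orbit lam, ∀ x,
    μ (E.right (E.rho r) (E.left (E.rho r)⁻¹ x)) = μ x}
  one_mem' := by simp [E.left_one, E.right_one]
  mul_mem' := by
    intro a b ha hb μ hμ x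
    rw [map_mul, mul_inv_rev, E.left_mul, E.right_mul, E.right_left (E.rho b)⁻¹, hb μ hμ, ha μ hμ]
  inv_mem' := by
    intro a ha μ hμ x
    rw [← ha μ hμ, E.right_left, E.right_left, E.right_left, ← E.right_mul, ← E.left_mul]
    simp [E.left_one, E.right_one]

lemma mem_fixer {lam : Module.Dual F J} {r : L} : r ∈ E.fixer lam ↔ ∀ μ ∈ E.orbit lam, ∀ x,
    μ (E.right (E.rho r) (E.left (E.rho r)⁻¹ x)) = μ x := Iff.rfl

instance fixer_normal (lam : Module.Dual F J) : (E.fixer lam).Normal where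
  conj_mem := by
    intro r hr s μ hμ x
    have := hr _ (E.biact_mem_orbit hμ (E.rho s)⁻¹ (E.rho s))
      (E.left (E.rho s)⁻¹ (E.right (E.rho s) x))
    simp only [biact_apply, E.right_left, ← E.left_mul, ← E.right_mul] at this
    simpa [E.right_left, E.left_one, E.right_one, mul_assoc] using this

lemma em_zero : E.em 0 = 1 := by
  have := E.em_mul 0 0
  simpa using this

lemma em_injective : Function.Injective E.em := by
  intro x y h
  have := @E.bijective.1 (1, x) (1, y) (by simpa using h)
  simpa using this

lemma em_inv [Fintype G] (a : J) : ∃ b, (E.em a)⁻¹ = E.em b := by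
  have hpow (n : ℕ) : ∃ b, E.em a ^ n = E.em b := by
    induction n with
    | zero => exact ⟨0, by simp [E.em_zero]⟩
    | succ n ih =>
      obtain ⟨b, hb⟩ := ih
      exact ⟨_, by rw [pow_succ, hb, E.em_mul]⟩
  obtain ⟨n, hn⟩ := (isOfFinOrder_of_finite (E.em a)).mem_powers_iff_mem_zpowers.2
    (inv_mem (Subgroup.mem_zpowers (E.em a)))
  simpa [← hn] using hpow n

lemma exists_conj_em [Fintype G] (lam : Module.Dual F J) (h : L) (a x : J) :
    ∃ y, E.em a * (E.rho h * E.em x) * (E.em a)⁻¹ = E.rho h * E.em y ∧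
      (h ∈ E.fixer lam → ∀ μ ∈ E.orbit lam, μ y = E.biact (E.em a)⁻¹ (E.em a) μ x) := by
  obtain ⟨b, hb⟩ := E.em_inv a
  have hab : a + b + a * b = 0 := E.em_injective (by rw [← E.em_mul, ← hb, E.em_zero]; simp)
  have hc := E.conj_em h⁻¹ a
  simp only [map_inv, inv_inv] at hc
  set c := E.left (E.rho h)⁻¹ (E.right (E.rho h) a) with hcdef
  refine ⟨(c + x + c * x) + b + (c + x + c * x) * b, ?_, ?_⟩
  · rw [← E.em_mul, ← E.em_mul, ← hc, hb]
    group
  · intro hh μ hμ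
    have hinv (z : J) : μ (E.right (E.em b) (E.right (E.rho h) (E.left (E.rho h)⁻¹ z))) =
        μ (E.right (E.em b) z) := by
      have := hh _ (E.biact_mem_orbit hμ (E.em b) 1) z
      simpa [E.left_one] using this
    have hbc : μ (c + b + c * b) = 0 := by
      have := hinv a
      rw [E.right_left, ← hcdef, E.right_em, E.right_em] at this
      rw [show c + b + c * b = c + c * b + b by abel, map_add, this, ← map_add,
        show a + a * b + b = a + b + a * b by abel, hab, map_zero]
    have hx : (c + x + c * x) + b + (c + x + c * x) * b =
        (c + b + c * b) + E.right (E.em b) (E.left (E.em c) x) := by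
      simp only [E.left_em, E.right_em, add_mul]
      abel
    have hz := hinv (E.right (E.rho h)⁻¹ (E.left (E.em a) (E.left (E.rho h) x)))
    have hx' := (E.fixer lam).inv_mem hh _ (E.biact_mem_orbit hμ (E.em b) (E.em a)) x
    simp only [biact_apply, map_inv, inv_inv, E.right_left, ← E.left_mul, ← E.right_mul] at hz hx'
    rw [hx, map_add, hbc, zero_add, ← hc, hb, biact_apply, ← hx', E.right_left]
    simpa [mul_assoc, E.right_one] using hz

lemma exists_conj [Fintype G] (lam : Module.Dual F J) (h k : L) (a x : J) :
    ∃ y, (E.rho k * E.em a) * (E.rho h * E.em x) * (E.rho k * E.em a)⁻¹ =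
        E.rho (k * h * k⁻¹) * E.em y ∧
      (h ∈ E.fixer lam → ∀ μ ∈ E.orbit lam, μ y = E.biact (E.rho k * E.em a)⁻¹ (E.rho k * E.em a) μ x) := by
  obtain ⟨y, hy, hμy⟩ := E.exists_conj_em lam h a x
  refine ⟨E.left (E.rho k) (E.right (E.rho k)⁻¹ y), ?_, fun hh μ hμ => ?_⟩
  · rw [← E.conj_em]
    calc _ = E.rho k * (E.em a * (E.rho h * E.em x) * (E.em a)⁻¹) * (E.rho k)⁻¹ := by group
      _ = _ := by rw [hy]; simp [mul_assoc]
  · rw [← biact_apply, hμy hh _ (E.biact_mem_orbit hμ _ _), biact_biact, mul_inv_rev]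

lemma sum_eq_sum_prod [Fintype L] [Fintype J] [Fintype G] (f : G → ℂ) :
    ∑ g, f g = ∑ p : L, ∑ w : J, f (E.rho p * E.em w) := by
  rw [← Fintype.sum_prod_type', ← (Equiv.ofBijective _ E.bijective).sum_comp]
  rfl

lemma card_eq (E : AlgebraGroupExtension F J L G) [Fintype L] [Fintype J]
    [Fintype G] : Fintype.card G = Fintype.card L * Fintype.card J := by
  rw [← Fintype.card_prod, Fintype.card_congr (Equiv.ofBijective _ E.bijective).symm]

lemma sum_biact_eq [Fintype L] [Fintype J] [Fintype G] [SMulCommClass F J J]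
    (ε : AddChar F ℂ) (hε : ε ≠ 1) (lam : Module.Dual F J) (c : J) :
    ∑ q, ε (E.biact q 1 lam c) =
      Fintype.card J * if ∀ w, lam (c * w) = 0 then
        ∑ p : L, ε (lam (E.right (E.rho p) c)) else 0 := by
  have hinner (p : L) : ∑ w, ε (E.biact (E.rho p * E.em w) 1 lam c) =
      ε (lam (E.right (E.rho p) c)) * ∑ w, ε (lam (c * w)) := by
    have hbij : Function.Bijective (E.left (E.rho p)) :=
      Function.bijective_iff_has_inverse.2 ⟨E.left (E.rho p)⁻¹,
        fun x => by rw [← E.left_mul]; simp [E.left_one],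
        fun x => by rw [← E.left_mul]; simp [E.left_one]⟩
    rw [← (Equiv.ofBijective _ hbij).sum_comp fun w => ε (lam (c * w)), Finset.mul_sum]
    refine Finset.sum_congr rfl fun w _ => ?_
    simp [E.right_mul, E.left_one, E.right_em, E.mul_left, AddChar.map_add_eq_mul]
  rw [E.sum_eq_sum_prod]
  simp only [hinner]
  rw [← Finset.sum_mul, mul_comm]
  by_cases hw : ∀ w, lam (c * w) = 0
  · simp [hw]
  · have hchar := sum_addChar_linear ε hε (lam ∘ₗ LinearMap.mulLeft F c)
    rw [if_neg hw, mul_zero]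
    exact mul_eq_zero_of_left (hchar.trans (if_neg hw)) _

/-- The sum of an extended character over conjugates, in terms of the two-sided orbit. -/
lemma card_mul_sum_conj [Fintype L] [Fintype J] [Fintype G] [SMulCommClass F J J]
    (ε : AddChar F ℂ) (hε : ε ≠ 1) (lam : Module.Dual F J) (θ : L → ℂ)
    (hθ : ∀ h ∉ E.fixer lam, θ h = 0)
    (hθconj : ∀ r, ∀ h ∈ E.fixer lam, θ (r * h * r⁻¹) = θ h) (ξ : G → ℂ)
    (hξ : ∀ h x, ξ (E.rho h * E.em x) =
      if h ∈ E.fixer lam ∧ ∀ w, lam (x * w) = 0 then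
        ∑ p : L, θ h * ε (lam (E.right (E.rho p) x)) else 0) (h : L) (x : J) :
    (Fintype.card J : ℂ) * Nat.card (E.orbit lam) *
        ∑ s, ξ (s * (E.rho h * E.em x) * s⁻¹) =
      (Fintype.card G : ℂ) ^ 2 * θ h * ∑ᶠ μ ∈ E.orbit lam, ε (μ x) := by
  by_cases hh : h ∈ E.fixer lam
  · have hs (s : G) : (Fintype.card J : ℂ) * ξ (s * (E.rho h * E.em x) * s⁻¹) =
        θ h * ∑ q, ε (E.biact q s lam x) := by
      obtain ⟨⟨k, a⟩, rfl⟩ := E.bijective.2 s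
      obtain ⟨y, hy, hμy⟩ := E.exists_conj lam h k a x
      have hsum : ∑ q, ε (E.biact q (E.rho k * E.em a) lam x) = ∑ q, ε (E.biact q 1 lam y) := by
        rw [← Equiv.sum_comp (Equiv.mulLeft (E.rho k * E.em a)⁻¹)]
        refine Finset.sum_congr rfl fun q _ => ?_
        rw [hμy hh _ ⟨(q, 1), rfl⟩, biact_biact, one_mul]
        rfl
      simp only [hy, hξ, hsum, E.sum_biact_eq ε hε, (E.fixer_normal lam).conj_mem h hh k,
        hθconj k h hh, true_and, ← Finset.mul_sum]
      split_ifs <;> ring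
    rw [mul_right_comm, Finset.mul_sum]
    simp only [hs]
    rw [← Finset.mul_sum, mul_assoc, mul_comm _ (Nat.card (E.orbit lam) : ℂ),
      E.card_orbit_mul_sum lam fun μ => ε (μ x)]
    ring
  · have hs (s : G) : ξ (s * (E.rho h * E.em x) * s⁻¹) = 0 := by
      obtain ⟨⟨k, a⟩, rfl⟩ := E.bijective.2 s
      obtain ⟨y, hy, -⟩ := E.exists_conj lam h k a x
      have hk : k * h * k⁻¹ ∉ E.fixer lam := fun hk => hh <| by
        simpa [mul_assoc] using (E.fixer_normal lam).conj_mem _ hk k⁻¹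
      simp only [hy, hξ, hk, false_and, if_false]
    simp [hs, hθ h hh]

lemma card_translates_mul_card_annihilator [Fintype J] [SMulCommClass F J J]
    (lam : Module.Dual F J) :
    Nat.card {μ : Module.Dual F J | ∃ z, ∀ x, μ x = lam (x + z * x)} *
      Nat.card {z : J | ∀ w, lam (z * w) = 0} = Fintype.card J := by
  let T : J →+ Module.Dual F J :=
    AddMonoidHom.mk' (fun z => lam ∘ₗ LinearMap.mulLeft F z) fun a b => by ext; simp [add_mul]
  have hker : {z : J | ∀ w, lam (z * w) = 0} = T.ker := by
    ext z
    simp [T, AddMonoidHom.mem_ker, LinearMap.ext_iff]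
  have htrans : {μ : Module.Dual F J | ∃ z, ∀ x, μ x = lam (x + z * x)} =
      (lam + ·) '' (T.range : Set (Module.Dual F J)) := by
    ext μ
    constructor
    · rintro ⟨z, hz⟩
      exact ⟨T z, ⟨z, rfl⟩, LinearMap.ext fun x => by simp [T, hz]⟩
    · rintro ⟨_, ⟨z, rfl⟩, rfl⟩
      exact ⟨z, fun x => by simp [T]⟩
  rw [htrans, Nat.card_image_of_injective (add_right_injective lam), hker, mul_comm,
    ← Nat.card_eq_fintype_card, ← T.ker.card_mul_index, AddSubgroup.index_ker]
  rfl

end AlgebraGroupExtension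

theorem stmt_8
    (F : Type) [Field F] [Fintype F]
    (J : Type) [NonUnitalRing J] [Module F J]
    [SMulCommClass F J J] [IsScalarTower F J J] [Fintype J]
    (hnil : ∃ N : ℕ, ∀ x : ℕ → J,
      (List.range N).foldr (fun i acc => x i * acc) (x N) = 0)
    (L : Type) [Group L] [Fintype L]
    (lact : L → J → J) (ract : J → L → J)
    (hlactlin : ∀ h : L, IsLinearMap F (lact h))
    (hractlin : ∀ h : L, IsLinearMap F (fun x => ract x h))
    (hlact_one : ∀ x : J, lact 1 x = x)
    (hlact_mul : ∀ h k : L, ∀ x : J, lact (h * k) x = lact h (lact k x))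
    (hract_one : ∀ x : J, ract x 1 = x)
    (hract_mul : ∀ h k : L, ∀ x : J, ract x (h * k) = ract (ract x h) k)
    (hcomm : ∀ h k : L, ∀ x : J, ract (lact h x) k = lact h (ract x k))
    (hlmul : ∀ h : L, ∀ x y : J, lact h (x * y) = lact h x * y)
    (hrmul : ∀ h : L, ∀ x y : J, ract (x * y) h = x * ract y h)
    (hmid : ∀ h : L, ∀ x y : J, x * lact h y = ract x h * y)
    (G : Type) [Group G] [Fintype G]
    (ρ : L →* G) (em : J → G)
    (hem : ∀ x y : J, em x * em y = em (x + y + x * y))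
    (hsplit : Function.Bijective (fun p : L × J => ρ p.1 * em p.2))
    (hconj : ∀ (h : L) (x : J), ρ h * em x * (ρ h)⁻¹ = em (lact h (ract x h⁻¹)))
    (ε : AddChar F ℂ) (hε : ε ≠ 1)
    (lam : Module.Dual F J) :
    let dec : G → L × J :=
      @Function.invFun (L × J) G ⟨(1, 0)⟩ fun p : L × J => ρ p.1 * em p.2
    let Jrt : Set J := {z : J | ∀ w : J, lam (z * w) = 0}
    let GlaG : Set (Module.Dual F J) :=
      {μ | ∃ (k : L) (w : J) (k' : L) (w' : J), ∀ x : J,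
        μ x = lam (ract (lact k' (x + w' * x)) k +
          ract (lact k' (x + w' * x)) k * w)}
    let laU : Set (Module.Dual F J) :=
      {μ | ∃ z : J, ∀ x : J, μ x = lam (x + z * x)}
    let Hset : Set L :=
      {r : L | ∀ μ ∈ GlaG, ∀ x : J, μ (ract (lact r⁻¹ x) r) = μ x}
    let ξdot : (L → ℂ) → G → ℂ := fun θ s =>
      if (dec s).1 ∈ Hset ∧ (dec s).2 ∈ Jrt then
        ∑ p : L, θ (dec s).1 * ε (lam (ract (dec s).2 p))
      else 0
    let χ : (L → ℂ) → G → ℂ := fun θ g =>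
      ((Nat.card ↥Hset * Nat.card ↥Jrt : ℕ) : ℂ)⁻¹ * ∑ s : G, ξdot θ (s * g * s⁻¹)
    (∃ N : Subgroup L, N.Normal ∧ (N : Set L) = Hset) ∧
    ∀ H₀ : Subgroup L, (H₀ : Set L) = Hset →
      ∀ θ : L → ℂ,
        (∃ W : FDRep ℂ ↥H₀, ∀ h : ↥H₀, θ ↑h = W.character h) →
        (∀ h : L, h ∉ H₀ → θ h = 0) →
        (∀ r k : L, k ∈ H₀ → θ (r * k * r⁻¹) = θ k) →
        ∀ (h : L) (x : J),
          χ θ (ρ h * em x) =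
            ((Fintype.card L : ℂ) ^ 2 * (Nat.card ↥laU : ℂ)) /
                ((Nat.card ↥Hset : ℂ) * (Nat.card ↥GlaG : ℂ)) *
              θ h * ∑ᶠ μ ∈ GlaG, ε (μ x) := by
  intro dec Jrt GlaG laU Hset ξdot χ
  have hdec (p : L × J) : dec (ρ p.1 * em p.2) = p :=
    @Function.leftInverse_invFun _ _ ⟨(1, 0)⟩ _ hsplit.1 p
  have hconj' (h : L) (x : J) : em x * ρ h = ρ h * em (lact h⁻¹ (ract x h)) := by
    have := hconj h⁻¹ x
    rw [inv_inv] at this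
    rw [← this]
    simp [mul_assoc]
  have hladd (h : L) := (hlactlin h).map_add
  have hradd (h : L) := (hractlin h).map_add
  have hmidl (h : L) (w x : J) : w * lact h x = lact h (lact h⁻¹ (ract w h) * x) := by
    rw [hlmul, ← hlact_mul, mul_inv_cancel, hlact_one, hmid]
  have hmul (p q : L × J) : ρ p.1 * em p.2 * (ρ q.1 * em q.2) =
      ρ (p.1 * q.1) * em (lact q.1⁻¹ (ract p.2 q.1) + q.2 + lact q.1⁻¹ (ract p.2 q.1) * q.2) := by
    rw [← hem, map_mul, mul_assoc, ← mul_assoc (em p.2), hconj']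
    simp only [mul_assoc]
  have hem0 : em 0 = 1 := by simpa using hem 0 0
  have hdec1 : dec 1 = (1, 0) := by simpa [hem0] using hdec (1, 0)
  have hdecρ (h : L) : dec (ρ h) = (h, 0) := by simpa [hem0] using hdec (h, 0)
  have hdecem (x : J) : dec (em x) = (1, x) := by simpa using hdec (1, x)
  let E : AlgebraGroupExtension F J L G :=
    { left := fun g => (hlactlin (dec g).1).mk' ∘ₗ (LinearMap.id + LinearMap.mulLeft F (dec g).2)
      right := fun g =>
        (LinearMap.id + LinearMap.mulRight F (dec g).2) ∘ₗ (hractlin (dec g).1).mk'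
      rho := ρ
      em := em
      left_one := by simp [hdec1, hlact_one]
      right_one := by simp [hdec1, hract_one]
      left_mul := by
        intro g k x
        obtain ⟨p, rfl⟩ := hsplit.2 g
        obtain ⟨q, rfl⟩ := hsplit.2 k
        have := hdec (p.1 * q.1, lact q.1⁻¹ (ract p.2 q.1) + q.2 + lact q.1⁻¹ (ract p.2 q.1) * q.2)
        simp only [hmul, hdec, this]
        simp only [LinearMap.comp_apply, IsLinearMap.mk'_apply, LinearMap.add_apply,
          LinearMap.id_apply, LinearMap.mulLeft_apply, hlact_mul, hmidl, ← hladd]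
        congr 2
        simp only [add_mul, mul_add, mul_assoc]
        abel
      right_mul := by
        intro g k x
        obtain ⟨p, rfl⟩ := hsplit.2 g
        obtain ⟨q, rfl⟩ := hsplit.2 k
        have := hdec (p.1 * q.1, lact q.1⁻¹ (ract p.2 q.1) + q.2 + lact q.1⁻¹ (ract p.2 q.1) * q.2)
        simp only [hmul, hdec, this]
        have hr : ract x (p.1 * q.1) * lact q.1⁻¹ (ract p.2 q.1) =
            ract (ract x p.1 * p.2) q.1 := by
          rw [hmid, ← hract_mul, mul_inv_cancel_right, hrmul]
        simp only [LinearMap.comp_apply, IsLinearMap.mk'_apply, LinearMap.add_apply,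
          LinearMap.id_apply, LinearMap.mulRight_apply, hradd, mul_add, ← mul_assoc, hr, add_mul]
        rw [hract_mul]
        abel
      right_left := by
        intro g k x
        simp only [LinearMap.comp_apply, IsLinearMap.mk'_apply, LinearMap.add_apply,
          LinearMap.id_apply, LinearMap.mulLeft_apply, LinearMap.mulRight_apply, hcomm, hladd,
          hradd, hrmul, hlmul, mul_add, add_mul, mul_assoc]
        abel
      mul_left := by
        intro g x y
        simp [hmid, mul_add, add_mul, mul_assoc]
      left_em := by simp [hdecem, hlact_one]
      right_em := by simp [hdecem, hract_one]
      em_mul := hem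
      bijective := hsplit
      conj_em := by
        intro h x
        rw [hconj, ← map_inv]
        simp [hdecρ, -map_inv] }
  have hleft (h : L) (x : J) : E.left (ρ h) x = lact h x := by simp [E, hdecρ]
  have hright (h : L) (x : J) : E.right (ρ h) x = ract x h := by simp [E, hdecρ]
  have horbit : GlaG = E.orbit lam := by
    ext μ
    constructor
    · rintro ⟨k, w, k', w', hμ⟩
      refine ⟨(ρ k * em w, ρ k' * em w'), LinearMap.ext fun x => ?_⟩
      rw [hμ, E.biact_apply, ← E.right_left]
      simp [E, hdec (k, w), hdec (k', w')]
    · rintro ⟨⟨g, g'⟩, rfl⟩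
      obtain ⟨⟨k, w⟩, rfl⟩ := hsplit.2 g
      obtain ⟨⟨k', w'⟩, rfl⟩ := hsplit.2 g'
      refine ⟨k, w, k', w', fun x => ?_⟩
      rw [E.biact_apply, ← E.right_left]
      simp [E, hdec (k, w), hdec (k', w')]
  have hfixer : Hset = E.fixer lam := by
    ext r
    simp only [Hset, horbit, Set.mem_ofPred_eq, SetLike.mem_coe, E.mem_fixer]
    simp only [show E.rho = ρ from rfl, ← map_inv, hleft, hright, hcomm]
  refine ⟨⟨E.fixer lam, E.fixer_normal lam, hfixer.symm⟩, ?_⟩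
  intro H₀ hH₀ θ _ hθ hθconj h x
  obtain rfl : H₀ = E.fixer lam := SetLike.coe_injective (hH₀.trans hfixer)
  have key := E.card_mul_sum_conj ε hε lam θ hθ (fun r k hk => hθconj r k hk) (ξdot θ)
    (fun k z => by
      have := hdec (k, z)
      simp only [ξdot, hfixer, Jrt, show E.rho = ρ from rfl, show E.em = em from rfl, hright]
      simp only [this, SetLike.mem_coe, Set.mem_ofPred_eq]) h x
  have hcard := AlgebraGroupExtension.card_translates_mul_card_annihilator lam
  have hJ : (Fintype.card J : ℂ) ≠ 0 := by simp
  have hO : (Nat.card (E.orbit lam) : ℂ) ≠ 0 := by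
    have : Finite (E.orbit lam) := Set.finite_range _
    have : Nonempty (E.orbit lam) := (Set.range_nonempty _).to_subtype
    exact_mod_cast Nat.card_pos.ne'
  have hH : (Nat.card Hset : ℂ) ≠ 0 := by
    rw [hfixer]
    exact_mod_cast (Nat.card_pos (α := E.fixer lam)).ne'
  have hcard' : (Nat.card laU : ℂ) * Nat.card Jrt = Fintype.card J := by exact_mod_cast hcard
  have hR : (Nat.card Jrt : ℂ) ≠ 0 := right_ne_zero_of_mul (hcard' ▸ hJ)
  simp only [χ]
  rw [horbit]
  rw [E.card_eq] at key
  push_cast at key ⊢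
  have key' : (Nat.card (E.orbit lam) : ℂ) * ∑ s, ξdot θ (s * (ρ h * em x) * s⁻¹) =
      (Fintype.card L : ℂ) ^ 2 * Fintype.card J * θ h * ∑ᶠ μ ∈ E.orbit lam, ε (μ x) := by
    apply mul_left_cancel₀ hJ
    linear_combination key
  rw [← hcard'] at key'
  field_simp
  linear_combination key'
end

section
/- For λ ∈ J* and a character θ of H_{GλG} constant on L-conjugacy classes, define the function χ_{θ,λ} on G by χ_{θ,λ}(h(1+x)) = (|L|²·|λU|)/(|H_{GλG}|·|GλG|) · θ̇(h) · Σ_{μ∈GλG} ε^{μ(x)}. Then: (1) if λ, λ' ∈ J* lie in distinct G×G orbits, then ⟨χ_{θ,λ}, χ_{θ',λ'}⟩ = 0 for all such characters θ of H_{GλG} and θ' of H_{Gλ'G}; (2) if θ and θ' are characters of H_{GλG} with ⟨θ,θ'⟩_{H_{GλG}} = 0, then ⟨χ_{θ,λ}, χ_{θ',λ}⟩ = 0. -/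
open scoped Classical

/-- Left multiplication by `1 + w` is injective when `w` is nilpotent. -/
lemma eq_zero_of_add_mul_eq_zero {J : Type*} [NonUnitalRing J] {N : ℕ}
    (hN : ∀ x : ℕ → J, (List.range N).foldr (fun i acc => x i * acc) (x N) = 0)
    {w y : J} (h : y + w * y = 0) : y = 0 := by
  have hy : -w * y = y := by rw [neg_mul]; exact (eq_neg_of_add_eq_zero_left h).symm
  have hfold : ∀ l : List ℕ, (∀ i ∈ l, i < N) →
      l.foldr (fun i acc => (if i < N then -w else y) * acc) y = y := by
    intro l
    induction l with
    | nil => simp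
    | cons a l ih =>
      intro hl
      rw [List.foldr_cons, ih fun i hi => hl i (List.mem_cons_of_mem _ hi),
        if_pos (hl a List.mem_cons_self), hy]
  have h0 := hN fun i => if i < N then -w else y
  simp only [lt_irrefl, if_false] at h0
  rwa [hfold _ fun i hi => List.mem_range.1 hi] at h0

/-- Right multiplication by `1 + w` is injective when `w` is nilpotent. -/
lemma eq_zero_of_add_mul_eq_zero_right {J : Type*} [NonUnitalRing J] {N : ℕ}
    (hN : ∀ x : ℕ → J, (List.range N).foldr (fun i acc => x i * acc) (x N) = 0)
    {w y : J} (h : y + y * w = 0) : y = 0 := by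
  have hy : y * -w = y := by rw [mul_neg]; exact (eq_neg_of_add_eq_zero_left h).symm
  have hfold : ∀ (l : List ℕ) (z : J), y * l.foldr (fun _ acc => -w * acc) z = y * z := by
    intro l z
    induction l with
    | nil => simp
    | cons a l ih => rw [List.foldr_cons, ← mul_assoc, hy, ih]
  have h0 := congrArg (y * ·) (hN fun _ => -w)
  simpa only [hfold, hy, mul_zero] using h0

/-- The translates of a functional by a composition-closed family of injective self-maps of a
finite set form equivalence classes. -/
lemma exists_comp_eq_of_comp_eq_comp {J R : Type*} [Finite J] {P : (J → J) → Prop}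
    (hid : P id) (hcomp : ∀ S T, P S → P T → P (S ∘ T))
    (hinj : ∀ T, P T → Function.Injective T)
    {f g : J → R} {S T : J → J} (hS : P S) (hT : P T) (h : f ∘ S = g ∘ T) :
    ∃ T', P T' ∧ g = f ∘ T' := by
  have hiter : ∀ n : ℕ, P (T^[n]) := by
    intro n
    induction n with
    | zero => exact hid
    | succ n ih => rw [Function.iterate_succ]; exact hcomp _ _ ih hT
  let e : Equiv.Perm J := Equiv.ofBijective T (Finite.injective_iff_bijective.1 (hinj T hT))
  have hpos : 0 < orderOf e := orderOf_pos e
  have he : T ∘ T^[orderOf e - 1] = id := by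
    rw [← Function.iterate_succ', Nat.succ_eq_add_one, Nat.sub_add_cancel hpos]
    have h1 : (e : J → J)^[orderOf e] = id := by
      rw [← Equiv.Perm.coe_pow, pow_orderOf_eq_one]; rfl
    exact h1
  refine ⟨S ∘ T^[orderOf e - 1], hcomp _ _ hS (hiter _), ?_⟩
  rw [← Function.comp_assoc, h, Function.comp_assoc, he, Function.comp_id]

/-- Distinct functionals give orthogonal additive characters. -/
lemma sum_addChar_dual_mul_conj_eq_zero {F J : Type*} [Field F] [Finite F] [AddCommGroup J]
    [Module F J] [Fintype J] {ε : AddChar F ℂ} (hε : ε ≠ 1) {μ ν : Module.Dual F J}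
    (h : μ ≠ ν) : ∑ x, ε (μ x) * (starRingEnd ℂ) (ε (ν x)) = 0 := by
  have hne : ε.compAddMonoidHom (μ - ν).toAddMonoidHom ≠ 1 := by
    obtain ⟨a, ha⟩ := AddChar.ne_one_iff.1 hε
    obtain ⟨x, hx⟩ := DFunLike.exists_ne (sub_ne_zero.2 h)
    refine AddChar.ne_one_iff.2 ⟨(a / (μ - ν) x) • x, ?_⟩
    have hx' : (μ - ν) x ≠ 0 := hx
    have hv : (μ - ν) ((a / (μ - ν) x) • x) = a := by
      rw [map_smul, smul_eq_mul, div_mul_cancel₀ _ hx']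
    change ε ((μ - ν) ((a / (μ - ν) x) • x)) ≠ 1
    rwa [hv]
  rw [← AddChar.sum_eq_zero_of_ne_one hne]
  refine Finset.sum_congr rfl fun x _ => ?_
  rw [← AddChar.map_neg_eq_conj, ← AddChar.map_add_eq_mul, ← sub_eq_add_neg]
  rfl

/-- Sums of additive characters over disjoint sets of functionals are orthogonal. -/
lemma sum_finsum_addChar_mul_conj_eq_zero {F J : Type*} [Field F] [Finite F] [AddCommGroup J]
    [Module F J] [Fintype J] {ε : AddChar F ℂ} (hε : ε ≠ 1) {A B : Set (Module.Dual F J)}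
    (h : Disjoint A B) :
    ∑ x, (∑ᶠ μ ∈ A, ε (μ x)) * (starRingEnd ℂ) (∑ᶠ ν ∈ B, ε (ν x)) = 0 := by
  have : Finite (Module.Dual F J) := DFunLike.finite _
  simp_rw [finsum_mem_eq_finite_toFinset_sum _ A.toFinite,
    finsum_mem_eq_finite_toFinset_sum _ B.toFinite, map_sum, Finset.sum_mul_sum]
  rw [Finset.sum_comm]
  refine Finset.sum_eq_zero fun μ hμ => ?_
  rw [Finset.sum_comm]
  refine Finset.sum_eq_zero fun ν hν => sum_addChar_dual_mul_conj_eq_zero hε ?_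
  exact h.ne_of_mem (A.toFinite.mem_toFinset.1 hμ) (B.toFinite.mem_toFinset.1 hν)

/-- The inner sum of two functions on a group with unique factorizations splits as a product. -/
lemma sum_decomposed_mul_conj {G L J : Type*} [Fintype G] [Fintype L] [Fintype J]
    {dec : G → L × J} (hdec : Function.Bijective dec) (c c' : ℂ) (θ θ' : L → ℂ) (s s' : J → ℂ) :
    ∑ g, (c * θ (dec g).1 * s (dec g).2) * (starRingEnd ℂ) (c' * θ' (dec g).1 * s' (dec g).2) =
      c * (starRingEnd ℂ) c' * (∑ h, θ h * (starRingEnd ℂ) (θ' h)) *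
        ∑ x, s x * (starRingEnd ℂ) (s' x) := by
  rw [hdec.sum_comp fun p : L × J =>
    (c * θ p.1 * s p.2) * (starRingEnd ℂ) (c' * θ' p.1 * s' p.2), Fintype.sum_prod_type,
    mul_assoc, Finset.sum_mul_sum, Finset.mul_sum]
  refine Finset.sum_congr rfl fun h _ => ?_
  rw [Finset.mul_sum]
  refine Finset.sum_congr rfl fun x _ => ?_
  simp only [map_mul]
  ring

theorem stmt_9
    (F : Type) [Field F] [Fintype F]
    (J : Type) [NonUnitalRing J] [Module F J]
    [SMulCommClass F J J] [IsScalarTower F J J] [Fintype J]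
    (hnil : ∃ N : ℕ, ∀ x : ℕ → J,
      (List.range N).foldr (fun i acc => x i * acc) (x N) = 0)
    (L : Type) [Group L] [Fintype L]
    (lact : L → J → J) (ract : J → L → J)
    (hlactlin : ∀ h : L, IsLinearMap F (lact h))
    (hractlin : ∀ h : L, IsLinearMap F (fun x => ract x h))
    (hlact_one : ∀ x : J, lact 1 x = x)
    (hlact_mul : ∀ h k : L, ∀ x : J, lact (h * k) x = lact h (lact k x))
    (hract_one : ∀ x : J, ract x 1 = x)
    (hract_mul : ∀ h k : L, ∀ x : J, ract x (h * k) = ract (ract x h) k)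
    (hcomm : ∀ h k : L, ∀ x : J, ract (lact h x) k = lact h (ract x k))
    (hlmul : ∀ h : L, ∀ x y : J, lact h (x * y) = lact h x * y)
    (hrmul : ∀ h : L, ∀ x y : J, ract (x * y) h = x * ract y h)
    (hmid : ∀ h : L, ∀ x y : J, x * lact h y = ract x h * y)
    (G : Type) [Group G] [Fintype G]
    (ρ : L →* G) (em : J → G)
    (hem : ∀ x y : J, em x * em y = em (x + y + x * y))
    (hsplit : Function.Bijective (fun p : L × J => ρ p.1 * em p.2))
    (hconj : ∀ (h : L) (x : J), ρ h * em x * (ρ h)⁻¹ = em (lact h (ract x h⁻¹)))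
    (ε : AddChar F ℂ) (hε : ε ≠ 1)
 :
    let dec : G → L × J :=
      @Function.invFun (L × J) G ⟨(1, 0)⟩ fun p : L × J => ρ p.1 * em p.2
    let GlaG : Module.Dual F J → Set (Module.Dual F J) := fun l =>
      {μ | ∃ (k : L) (w : J) (k' : L) (w' : J), ∀ x : J,
        μ x = l (ract (lact k' (x + w' * x)) k +
          ract (lact k' (x + w' * x)) k * w)}
    let laU : Module.Dual F J → Set (Module.Dual F J) := fun l =>
      {μ | ∃ z : J, ∀ x : J, μ x = l (x + z * x)}
    let Hset : Module.Dual F J → Set L := fun l =>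
      {r : L | ∀ μ ∈ GlaG l, ∀ x : J, μ (ract (lact r⁻¹ x) r) = μ x}
    let IsCharOn : Module.Dual F J → (L → ℂ) → Prop := fun l θ =>
      (∀ h : L, h ∉ Hset l → θ h = 0) ∧ (∀ r k : L, θ (r * k * r⁻¹) = θ k) ∧
      ∃ H₀ : Subgroup L, (H₀ : Set L) = Hset l ∧
        ∃ W : FDRep ℂ ↥H₀, ∀ h : ↥H₀, θ ↑h = W.character h
    let χ : Module.Dual F J → (L → ℂ) → G → ℂ := fun l θ g =>
      ((Fintype.card L : ℂ) ^ 2 * (Nat.card ↥(laU l) : ℂ)) /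
          ((Nat.card ↥(Hset l) : ℂ) * (Nat.card ↥(GlaG l) : ℂ)) *
        θ (dec g).1 * ∑ᶠ μ ∈ GlaG l, ε (μ (dec g).2)
    let inner : (G → ℂ) → (G → ℂ) → ℂ := fun f₁ f₂ =>
      (Fintype.card G : ℂ)⁻¹ * ∑ g : G, f₁ g * (starRingEnd ℂ) (f₂ g)
    (∀ (lam lam' : Module.Dual F J) (θ θ' : L → ℂ),
      IsCharOn lam θ → IsCharOn lam' θ' → lam' ∉ GlaG lam →
      inner (χ lam θ) (χ lam' θ') = 0) ∧
    (∀ (lam : Module.Dual F J) (θ θ' : L → ℂ),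
      IsCharOn lam θ → IsCharOn lam θ' →
      (Nat.card ↥(Hset lam) : ℂ)⁻¹ *
          (∑ᶠ h ∈ Hset lam, θ h * (starRingEnd ℂ) (θ' h)) = 0 →
      inner (χ lam θ) (χ lam θ') = 0) := by
  intro dec GlaG laU Hset IsCharOn χ inner
  have hdec : Function.Bijective dec := by
    have : Nonempty (L × J) := ⟨(1, 0)⟩
    exact ⟨(Function.rightInverse_invFun hsplit.2).injective,
      (Function.leftInverse_invFun hsplit.1).surjective⟩
  have hinner : ∀ lam lam' θ θ', (∑ h, θ h * (starRingEnd ℂ) (θ' h) = 0 ∨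
      ∑ x, (∑ᶠ μ ∈ GlaG lam, ε (μ x)) * (starRingEnd ℂ) (∑ᶠ μ ∈ GlaG lam', ε (μ x)) = 0) →
      inner (χ lam θ) (χ lam' θ') = 0 := by
    intro lam lam' θ θ' h
    refine mul_eq_zero_of_right _ ((sum_decomposed_mul_conj hdec _ _ θ θ'
      (fun x => ∑ᶠ μ ∈ GlaG lam, ε (μ x)) (fun x => ∑ᶠ μ ∈ GlaG lam', ε (μ x))).trans ?_)
    rcases h with h | h <;> simp [h]
  refine ⟨fun lam lam' θ θ' _ _ hlam => hinner _ _ _ _ (.inr ?_),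
    fun lam θ θ' hθ _ h => hinner _ _ _ _ (.inl ?_)⟩
  · refine sum_finsum_addChar_mul_conj_eq_zero hε (Set.disjoint_left.2 fun μ hμ hμ' => hlam ?_)
    obtain ⟨N, hN⟩ := hnil
    have hladd (h : L) (x y : J) : lact h (x + y) = lact h x + lact h y := (hlactlin h).map_add x y
    have hradd (h : L) (x y : J) : ract (x + y) h = ract x h + ract y h := (hractlin h).map_add x y
    have hlinv (h : L) (x : J) : lact h (lact h⁻¹ x) = x := by
      rw [← hlact_mul, mul_inv_cancel, hlact_one]
    have hlinv' (h : L) (x : J) : lact h⁻¹ (lact h x) = x := by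
      rw [← hlact_mul, inv_mul_cancel, hlact_one]
    have hrinv (h : L) (x : J) : ract (ract x h) h⁻¹ = x := by
      rw [← hract_mul, mul_inv_cancel, hract_one]
    let T : L → J → L → J → J → J := fun k w k' w' x =>
      ract (lact k' (x + w' * x)) k + ract (lact k' (x + w' * x)) k * w
    obtain ⟨k₁, w₁, k₁', w₁', h₁⟩ := hμ
    obtain ⟨k₂, w₂, k₂', w₂', h₂⟩ := hμ'
    obtain ⟨_, ⟨k, w, k', w', rfl⟩, hT⟩ := exists_comp_eq_of_comp_eq_comp
      (P := fun S => ∃ k w k' w', S = T k w k' w') (f := lam) (g := lam')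
      ⟨1, 0, 1, 0, by funext x; simp [T, hract_one, hlact_one]⟩
      (by
        rintro _ _ ⟨k, w, k', w', rfl⟩ ⟨l, v, l', v', rfl⟩
        let b := lact l'⁻¹ (ract w' l')
        let c := ract (lact k⁻¹ v) k
        refine ⟨l * k, c + w + c * w, k' * l', v' + b + b * v', ?_⟩
        funext x
        have hb (y : J) : w' * lact l' y = lact l' (b * y) := by
          rw [hmid, ← hlmul, hlinv]
        have hc (y : J) : y * ract v k = ract y k * c := by
          rw [← hmid, show c = lact k⁻¹ (ract v k) from hcomm _ _ _, hlinv]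
        have hu : x + (v' + b + b * v') * x = x + v' * x + b * (x + v' * x) := by
          noncomm_ring
        simp only [T, Function.comp_apply, hu, hract_mul, hlact_mul, hcomm]
        generalize x + v' * x = u
        simp only [← hlmul, ← hladd, hb, hcomm]
        simp only [hradd, hrmul, hc, mul_add, add_mul, ← mul_assoc, hladd]
        abel)
      (by
        rintro _ ⟨k, w, k', w', rfl⟩ x y hxy
        have hsub : T k w k' w' (x - y) = 0 := by
          rw [← sub_eq_zero.2 hxy]
          have hlsub (h : L) (x y : J) : lact h (x - y) = lact h x - lact h y :=
            (hlactlin h).map_sub x y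
          have hrsub (h : L) (x y : J) : ract (x - y) h = ract x h - ract y h :=
            (hractlin h).map_sub x y
          simp only [T, hladd, hradd, hlsub, hrsub, mul_sub, add_mul, sub_mul]
          abel
        have h1 := eq_zero_of_add_mul_eq_zero_right hN hsub
        have h2 : x - y + w' * (x - y) = 0 := by
          have h3 := congrArg (fun z => lact k'⁻¹ (ract z k⁻¹)) h1
          simpa only [hrinv, hlinv', (hractlin k⁻¹).map_zero, (hlactlin k'⁻¹).map_zero] using h3
        exact sub_eq_zero.1 (eq_zero_of_add_mul_eq_zero hN h2))
      ⟨k₁, w₁, k₁', w₁', rfl⟩ ⟨k₂, w₂, k₂', w₂', rfl⟩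
      (funext fun x => (h₁ x).symm.trans (h₂ x))
    exact ⟨k, w, k', w', congrFun hT⟩
  · have h1 : (1 : L) ∈ Hset lam := fun μ _ x => by rw [inv_one, hlact_one, hract_one]
    have hcard : (Nat.card ↥(Hset lam) : ℂ)⁻¹ ≠ 0 := by
      have : Nonempty ↥(Hset lam) := ⟨⟨1, h1⟩⟩
      exact inv_ne_zero (Nat.cast_ne_zero.2 Nat.card_pos.ne')
    rw [← (mul_eq_zero.1 h).resolve_left hcard, finsum_mem_def, finsum_eq_sum_of_fintype]
    refine Finset.sum_congr rfl fun h _ => ?_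
    by_cases hh : h ∈ Hset lam
    · rw [Set.indicator_of_mem hh]
    · rw [Set.indicator_of_notMem hh, hθ.1 h hh, zero_mul]
end
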